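/- arXiv:1503.03536 — 4 statements merged into one kernel-verified Lean document; each statement's English description precedes it below -/
import Mathlib

section
/- Assume GCH. Let X be a Banach space and Γ a singular cardinal. Suppose F ∈ C^{1,+}(B_{ℓ∞(Γ)}; X) satisfies inf_{γ<Γ} ‖F(e_γ) − F(0)‖ > 0. Then for every cardinal Λ < Γ there exist a point x in the open unit ball of ℓ∞(Γ) and a subspace Y ⊆ ℓ∞(Γ) isomorphic to ℓ∞(Λ) such that dF(x) restricted to Y is bounded below, i.e., there is l > 0 with ‖dF(x)[y]‖ ≥ l‖y‖ for all y ∈ Y. -/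
open Metric

universe u v

open Cardinal in
theorem exists_maximal_free {α : Type u} (C : α → Set α) (S : Set α) :
    ∃ M ⊆ S, (M.Pairwise fun a b => b ∉ C a) ∧
      ∀ x ∈ S, x ∉ M → ∃ m ∈ M, m ∈ C x ∨ x ∈ C m := by
  obtain ⟨M, hM⟩ := zorn_subset {M : Set α | M ⊆ S ∧ M.Pairwise fun a b => b ∉ C a} (by
    intro c hc hchain
    refine ⟨⋃₀ c, ⟨Set.sUnion_subset fun s hs => (hc hs).1, ?_⟩, fun s hs => Set.subset_sUnion_of_mem hs⟩
    exact (Set.pairwise_sUnion hchain.directedOn).2 fun s hs => (hc hs).2)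
  refine ⟨M, hM.prop.1, hM.prop.2, fun x hx hxM => ?_⟩
  by_contra! hcon
  refine hxM (hM.le_of_ge (y := insert x M) ⟨Set.insert_subset hx hM.prop.1, ?_⟩
    (Set.subset_insert x M) (Set.mem_insert x M))
  refine (Set.pairwise_insert).2 ⟨hM.prop.2, fun b hb _ => hcon b hb⟩

open Cardinal in
/-- A set mapping with values of size at most `κ` on a set of size greater than `κ⁺` has a free
set of size `κ`. -/
theorem exists_free_set {α : Type u} (C : α → Set α) (S : Set α) (κ : Cardinal.{u})
    (hκ : ℵ₀ ≤ κ) (hC : ∀ a, #(C a) ≤ κ) (hS : Order.succ κ < #S) :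
    ∃ A ⊆ S, #A = κ ∧ A.Pairwise fun a b => b ∉ C a := by
  by_contra! hno
  have hsmall : ∀ M ⊆ S, (M.Pairwise fun a b => b ∉ C a) → #M ≤ κ := by
    intro M hMS hM
    by_contra! hlt
    obtain ⟨A, hAM, hA⟩ := Cardinal.le_mk_iff_exists_subset.1 hlt.le
    exact hno A (hAM.trans hMS) hA (hM.mono hAM)
  choose mf hmf1 hmf2 hmf3 using exists_maximal_free C
  let K := (Order.succ κ).ord.ToType
  have hK : #K = Order.succ κ := by simp [K]
  let M : K → Set α := WellFoundedLT.fix fun ξ ih => mf (S \ ⋃ η, ⋃ h : η < ξ, ih η h)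
  have hM : ∀ ξ, M ξ = mf (S \ ⋃ η, ⋃ _ : η < ξ, M η) := fun ξ =>
    WellFoundedLT.fix_eq _ ξ
  have hMsub : ∀ ξ, M ξ ⊆ S \ ⋃ η, ⋃ _ : η < ξ, M η := fun ξ => by
    conv_lhs => rw [hM ξ]
    exact hmf1 _
  have hMcard : ∀ ξ, #(M ξ) ≤ κ := fun ξ => by
    refine hsmall _ ((hMsub ξ).trans Set.sdiff_subset) ?_
    rw [hM ξ]; exact hmf2 _
  have hMdisj : ∀ ξ η, ξ ≠ η → Disjoint (M ξ) (M η) := by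
    have key : ∀ ξ η, η < ξ → Disjoint (M ξ) (M η) := fun ξ η h =>
      Set.disjoint_left.2 fun x hx hx' =>
        (hMsub ξ hx).2 (Set.mem_iUnion₂.2 ⟨η, h, hx'⟩)
    intro ξ η hne
    rcases lt_or_gt_of_ne hne with h | h
    · exact (key η ξ h).symm
    · exact key ξ η h
  have hω : ℵ₀ ≤ Order.succ κ := hκ.trans (Order.le_succ κ)
  have hU : #(⋃ ξ, (M ξ ∪ ⋃ m ∈ M ξ, C m) : Set α) ≤ Order.succ κ := by
    refine (mk_iUnion_le_sum_mk).trans ((sum_le_mk_mul_iSup _).trans ?_)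
    rw [hK]
    refine (mul_le_mul' le_rfl (ciSup_le' fun ξ => ?_)).trans (mul_eq_self hω).le
    refine (mk_union_le _ _).trans ((add_le_add ((hMcard ξ).trans (Order.le_succ κ)) ?_).trans
      (add_eq_self hω).le)
    rw [Set.biUnion_eq_iUnion]
    refine (mk_iUnion_le_sum_mk).trans ((sum_le_mk_mul_iSup _).trans ?_)
    refine (mul_le_mul' (hMcard ξ) (ciSup_le' fun m : M ξ => hC m)).trans ?_
    rw [mul_eq_self hκ]; exact Order.le_succ κ
  obtain ⟨x, hxS, hxU⟩ : ∃ x ∈ S, x ∉ ⋃ ξ, (M ξ ∪ ⋃ m ∈ M ξ, C m) := by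
    by_contra! hsub
    exact absurd ((mk_le_mk_of_subset hsub).trans hU) hS.not_ge
  simp only [Set.mem_iUnion, Set.mem_union, not_exists, not_or] at hxU
  have hmeet : ∀ ξ, ∃ m ∈ M ξ, m ∈ C x := by
    intro ξ
    obtain ⟨m, hm, h⟩ := hmf3 (S \ ⋃ η, ⋃ _ : η < ξ, M η) x
      ⟨hxS, by simp only [Set.mem_iUnion, not_exists]; exact fun η _ => (hxU η).1⟩
      (by rw [← hM ξ]; exact (hxU ξ).1)
    rw [← hM ξ] at hm
    exact ⟨m, hm, h.resolve_right ((hxU ξ).2 m hm)⟩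
  choose m hm hmC using hmeet
  have hinj : Function.Injective fun ξ => (⟨m ξ, hmC ξ⟩ : C x) := by
    intro ξ η h
    by_contra hne
    have h' : m ξ = m η := congrArg Subtype.val h
    exact Set.disjoint_left.1 (hMdisj ξ η hne) (hm ξ) (h' ▸ hm η)
  have := (mk_le_of_injective hinj).trans (hC x)
  rw [hK] at this
  exact absurd this (Order.lt_succ κ).not_ge

open Cardinal in
theorem exists_subset_forall_diff_singleton_notMem {α : Type u} (S : Set α) (κ : Cardinal.{u})
    (hκ : ℵ₀ ≤ κ) (hS : Order.succ κ < #S) (bad : α → Set (Set α))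
    (hbad : ∀ a, ∀ 𝓢 ⊆ bad a, 𝓢.PairwiseDisjoint id → 𝓢.Finite) :
    ∃ A ⊆ S, #A = κ ∧ ∀ a ∈ A, A \ {a} ∉ bad a := by
  have hmax : ∀ a, ∃ 𝓢, Maximal
      (fun 𝓢 : Set (Set α) => 𝓢 ⊆ {B ∈ bad a | #B ≤ κ} ∧ 𝓢.PairwiseDisjoint id) 𝓢 := by
    intro a
    refine zorn_subset {𝓢 : Set (Set α) | 𝓢 ⊆ {B ∈ bad a | #B ≤ κ} ∧ 𝓢.PairwiseDisjoint id} ?_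
    intro c hc hchain
    refine ⟨⋃₀ c, ⟨Set.sUnion_subset fun s hs => (hc hs).1, ?_⟩,
      fun s hs => Set.subset_sUnion_of_mem hs⟩
    exact (Set.pairwise_sUnion hchain.directedOn).2 fun s hs => (hc hs).2
  choose 𝓢 h𝓢 using hmax
  have hcard : ∀ a, #(⋃₀ 𝓢 a : Set α) ≤ κ := by
    intro a
    have hfin : (𝓢 a).Finite :=
      hbad a _ (fun B hB => ((h𝓢 a).prop.1 hB).1) (h𝓢 a).prop.2
    have : Finite (𝓢 a) := hfin
    rw [Set.sUnion_eq_iUnion]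
    refine (mk_iUnion_le _).trans ?_
    refine (mul_le_mul' ((lt_aleph0_of_finite _).le.trans hκ)
      (ciSup_le' fun B => ((h𝓢 a).prop.1 B.2).2)).trans (mul_eq_self hκ).le
  obtain ⟨A, hAS, hA, hfree⟩ := exists_free_set (fun a => ⋃₀ 𝓢 a) S κ hκ hcard hS
  refine ⟨A, hAS, hA, fun a ha hmem => ?_⟩
  have hdisj : Disjoint (A \ {a}) (⋃₀ 𝓢 a) :=
    Set.disjoint_left.2 fun b hb => hfree ha hb.1 (Ne.symm hb.2)
  have hin : A \ {a} ∈ 𝓢 a := by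
    refine (h𝓢 a).le_of_ge (y := insert (A \ {a}) (𝓢 a)) ⟨Set.insert_subset
      ⟨hmem, (mk_le_mk_of_subset Set.sdiff_subset).trans hA.le⟩ (h𝓢 a).prop.1, ?_⟩
      (Set.subset_insert _ _) (Set.mem_insert _ _)
    exact (h𝓢 a).prop.2.insert fun B hB _ => hdisj.mono_right (Set.subset_sUnion_of_mem hB)
  have hemp : A \ {a} = ∅ := by
    have := hdisj.mono_right (Set.subset_sUnion_of_mem hin)
    simpa using this
  have hsub : A ⊆ {a} := Set.sdiff_eq_empty.1 hemp
  have : #A < ℵ₀ := lt_aleph0_iff_set_finite.2 ((Set.finite_singleton a).subset hsub)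
  exact absurd hκ (hA ▸ this).not_ge

/-- A random walk argument: a function on `ℝ^ι` that is uniformly smooth at scale `h` and whose
derivative is invariant under permutations of the coordinates hardly varies along a single coordinate axis, provided the
index set is large. -/
theorem symmetric_sub_le {p m : ℕ} (hm : 0 < m)
    (φ : (Option ((Fin p → SignType) × Fin m) → ℝ) → ℝ)
    (D : (Option ((Fin p → SignType) × Fin m) → ℝ) →
      (Option ((Fin p → SignType) × Fin m) → ℝ) →ₗ[ℝ] ℝ)
    {h η L : ℝ} (hh : 0 ≤ h)
    (hT : ∀ x w, ‖x‖ ≤ p * h → ‖x + w‖ ≤ p * h → ‖w‖ ≤ h → |φ (x + w) - φ x - D x w| ≤ h * η)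
    (hL : ∀ x w, ‖x‖ ≤ p * h → ‖w‖ ≤ 1 → |D x w| ≤ L)
    (hD : ∀ (σ : Equiv.Perm _) x w, D (x ∘ σ) (w ∘ σ) = D x w) :
    φ (Pi.single none (p * h)) - φ 0 ≤ 3 * (p * (h * η)) + p * (h * (L / m)) := by
  have hph : 0 ≤ p * h := by positivity
  have hmR : (0 : ℝ) < m := by exact_mod_cast hm
  let X : ℝ → ℕ → Option ((Fin p → SignType) × Fin m) → ℝ := fun c k i =>
    i.elim c fun e => h * ∑ l : Fin p, if l.1 < k then ((e.1 l : SignType) : ℝ) else 0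
  let V : Fin p → Option ((Fin p → SignType) × Fin m) → ℝ := fun k i =>
    i.elim 0 fun e => h * ((e.1 k : SignType) : ℝ)
  have hsign : ∀ s : SignType, |(s : ℝ)| ≤ 1 := by
    intro s; cases s <;> simp
  have hX : ∀ c k, |c| ≤ p * h → ‖X c k‖ ≤ p * h := by
    intro c k hc
    refine (pi_norm_le_iff_of_nonneg hph).2 fun i => ?_
    rcases i with _ | e
    · exact hc
    · change |h * _| ≤ _
      rw [abs_mul, abs_of_nonneg hh, mul_comm]
      refine mul_le_mul_of_nonneg_right ?_ hh
      refine (Finset.abs_sum_le_sum_abs _ _).trans ?_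
      calc _ ≤ ∑ l : Fin p, (1 : ℝ) := Finset.sum_le_sum fun l _ => by
            split_ifs
            · exact hsign _
            · simp
        _ = p := by simp
  have hV : ∀ k, ‖V k‖ ≤ h := by
    intro k
    refine (pi_norm_le_iff_of_nonneg hh).2 fun i => ?_
    rcases i with _ | e
    · simpa [V] using hh
    · change |h * _| ≤ _
      rw [abs_mul, abs_of_nonneg hh]
      exact mul_le_of_le_one_right hh (hsign _)
  have hstep : ∀ c (k : Fin p), X c (k + 1) = X c k + V k := by
    intro c k
    funext i
    rcases i with _ | e
    · simp [X, V]
    · simp only [X, V, Option.elim, Pi.add_apply, ← mul_add]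
      congr 1
      have : ((e.1 k : SignType) : ℝ) = ∑ l : Fin p, if l = k then ((e.1 l : SignType) : ℝ) else 0 := by
        simp
      rw [this, ← Finset.sum_add_distrib]
      refine Finset.sum_congr rfl fun l _ => ?_
      rcases lt_trichotomy l k with hl | hl | hl
      · have h1 : l.1 < k.1 := hl
        simp [h1, hl.ne, h1.trans (Nat.lt_succ_self _)]
      · subst hl; simp
      · have h1 : k.1 < l.1 := hl
        simp [hl.ne', show ¬ l.1 < k.1 from by omega, show ¬ l.1 < k.1 + 1 from by omega]
  let σ : Fin p → Equiv.Perm (Option ((Fin p → SignType) × Fin m)) := fun k =>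
    Function.Involutive.toPerm (fun i => i.map fun e => (Function.update e.1 k (-e.1 k), e.2)) (by
      intro i; rcases i with _ | e <;> simp)
  have hDV : ∀ c (k : Fin p), D (X c k) (V k) = 0 := by
    intro c k
    have h1 : X c k ∘ σ k = X c k := by
      funext i
      rcases i with _ | e
      · rfl
      · change h * _ = h * _
        congr 1
        refine Finset.sum_congr rfl fun l _ => ?_
        split_ifs with hl
        · have : l ≠ k := fun h => by subst h; exact lt_irrefl _ hl
          simp [Function.update_of_ne this]
        · rfl
    have h2 : V k ∘ σ k = -V k := by
      funext i
      rcases i with _ | e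
      · change (0 : ℝ) = -0
        simp
      · change h * ((Function.update e.1 k (-e.1 k) k : SignType) : ℝ) = -(h * _)
        simp
    have := hD (σ k) (X c k) (V k)
    rw [h1, h2, map_neg] at this
    linarith
  have hwalk : ∀ c, |c| ≤ p * h → ∀ k ≤ p, |φ (X c k) - φ (X c 0)| ≤ k * (h * η) := by
    intro c hc k
    induction k with
    | zero => intro _; simp
    | succ k ih =>
      intro hk
      have h1 := hstep c ⟨k, hk⟩
      have h2 := hT (X c k) (V ⟨k, hk⟩) (hX c k hc) (by rw [← h1]; exact hX c _ hc) (hV _)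
      rw [← h1, hDV c ⟨k, hk⟩, sub_zero] at h2
      have h3 := ih (by omega)
      rw [abs_le] at h2 h3 ⊢
      push_cast
      constructor <;> linarith [h2.1, h2.2, h3.1, h3.2]
  have hclimb : ∀ j < p, φ (X ((j + 1 : ℕ) * h) p) - φ (X (j * h) p) ≤ h * η + h * (L / m) := by
    intro j hj
    have hc : ∀ i ≤ p, |(i : ℝ) * h| ≤ p * h := fun i hi => by
      rw [abs_of_nonneg (by positivity)]; gcongr
    have h1 : X ((j + 1 : ℕ) * h) p = X (j * h) p + Pi.single none h := by
      funext i
      rcases i with _ | e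
      · simp [X]; ring
      · simp [X]
    let q : Fin m → Option ((Fin p → SignType) × Fin m) := fun r =>
      some (fun l => if l.1 < j then 1 else 0, r)
    have hq : ∀ r, X (j * h) p (q r) = j * h := by
      intro r
      simp only [X, q, Option.elim]
      have : ∀ l : Fin p, (if l.1 < p then (((if l.1 < j then 1 else 0 : SignType)) : ℝ) else 0)
          = if l.1 < j then 1 else 0 := by
        intro l
        rw [if_pos l.2]
        split_ifs <;> simp
      rw [Finset.sum_congr rfl fun l _ => this l, Finset.sum_boole, Fin.card_filter_val_lt,
        min_eq_right hj.le, mul_comm]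
    have hnone : X (j * h) p none = j * h := rfl
    have hswap : ∀ r, D (X (j * h) p) (Pi.single none 1) = D (X (j * h) p) (Pi.single (q r) 1) := by
      intro r
      have h2 : X (j * h) p ∘ Equiv.swap none (q r) = X (j * h) p := by
        funext i
        simp only [Function.comp_apply]
        rw [Equiv.swap_apply_def]
        split_ifs with h3 h3
        · rw [h3, hq, hnone]
        · rw [h3, hq, hnone]
        · rfl
      have h3 : (Pi.single (q r) 1 : _ → ℝ) ∘ Equiv.swap none (q r) = Pi.single none 1 := by
        funext i
        simp only [Function.comp_apply, Pi.single_apply]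
        congr 1
        rw [Equiv.swap_apply_eq_iff, Equiv.swap_apply_right]
      conv_rhs => rw [← hD (Equiv.swap none (q r)), h2, h3]
    have hqinj : Function.Injective q := fun r s hrs => by
      simpa [q] using hrs
    have hsum : (m : ℝ) * D (X (j * h) p) (Pi.single none 1) ≤ L := by
      have h2 : (m : ℝ) * D (X (j * h) p) (Pi.single none 1) =
          D (X (j * h) p) (∑ r, Pi.single (q r) 1) := by
        rw [map_sum, ← Finset.sum_congr rfl fun r _ => hswap r]
        simp
      rw [h2]
      refine (le_abs_self _).trans (hL _ _ (hX _ _ (hc j hj.le)) ?_)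
      refine (pi_norm_le_iff_of_nonneg zero_le_one).2 fun i => ?_
      rw [Finset.sum_apply]
      by_cases hi : ∃ r, q r = i
      · obtain ⟨r, rfl⟩ := hi
        rw [Finset.sum_eq_single r]
        · simp
        · intro s _ hs
          exact Pi.single_eq_of_ne (fun h => hs (hqinj h).symm) _
        · simp
      · rw [Finset.sum_eq_zero]
        · simp
        · intro s _
          exact Pi.single_eq_of_ne (fun h => hi ⟨s, h.symm⟩) _
    have hsingle : (Pi.single none h : _ → ℝ) = h • (Pi.single none 1 :
        Option ((Fin p → SignType) × Fin m) → ℝ) := by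
      rw [← Pi.single_smul]; simp
    have h2 := hT (X (j * h) p) (Pi.single none h) (hX _ _ (hc j hj.le))
      (by rw [← h1]; exact hX _ _ (hc _ hj)) (by rw [Pi.norm_single, Real.norm_of_nonneg hh])
    rw [← h1] at h2
    have h3 : D (X (j * h) p) (Pi.single none h) ≤ h * (L / m) := by
      rw [hsingle, map_smul, smul_eq_mul]
      refine mul_le_mul_of_nonneg_left ?_ hh
      rw [le_div_iff₀ hmR]; linarith
    linarith [(abs_le.1 h2).2]
  have hclimbs : ∀ j ≤ p, φ (X (j * h) p) - φ (X 0 p) ≤ j * (h * η + h * (L / m)) := by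
    intro j
    induction j with
    | zero => intro _; simp
    | succ j ih =>
      intro hj
      have := ih (by omega)
      have := hclimb j hj
      push_cast at *
      linarith
  have e1 := hclimbs p le_rfl
  have e2 := hwalk 0 (by simpa using hph) p le_rfl
  have e3 := hwalk (p * h) (by rw [abs_of_nonneg hph]) p le_rfl
  have f1 : X 0 0 = 0 := by
    funext i
    rcases i with _ | e <;> simp [X]
  have f2 : X (p * h) 0 = Pi.single none (p * h) := by
    funext i
    rcases i with _ | e <;> simp [X]
  rw [f1] at e2
  rw [f2] at e3
  have e2' := (abs_le.1 e2).2
  have e3' := (abs_le.1 e3).1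
  linarith

theorem exists_single_sub_le {p m : ℕ} (hm : 0 < m)
    (φ : (Option ((Fin p → SignType) × Fin m) → ℝ) → ℝ)
    (D : (Option ((Fin p → SignType) × Fin m) → ℝ) →
      (Option ((Fin p → SignType) × Fin m) → ℝ) →ₗ[ℝ] ℝ)
    {h η L : ℝ} (hh : 0 ≤ h)
    (hT : ∀ x w, ‖x‖ ≤ p * h → ‖x + w‖ ≤ p * h → ‖w‖ ≤ h → |φ (x + w) - φ x - D x w| ≤ h * η)
    (hL : ∀ x w, ‖x‖ ≤ p * h → ‖w‖ ≤ 1 → |D x w| ≤ L) :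
    ∃ i, φ (Pi.single i (p * h)) - φ 0 ≤ 3 * (p * (h * η)) + p * (h * (L / m)) := by
  classical
  by_contra! hcon
  let ι := Option ((Fin p → SignType) × Fin m)
  let N : ℝ := Fintype.card (Equiv.Perm ι)
  have hN : 0 < N := by
    have : 0 < Fintype.card (Equiv.Perm ι) := Fintype.card_pos
    exact Nat.cast_pos.2 this
  have hnorm : ∀ (τ : Equiv.Perm ι) (x : ι → ℝ), ‖x ∘ τ‖ ≤ ‖x‖ := fun τ x =>
    (pi_norm_le_iff_of_nonneg (norm_nonneg _)).2 fun i => norm_le_pi_norm x _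
  have hconst : ∀ c : ℝ, ∑ _τ : Equiv.Perm ι, c = N * c := fun c => by simp [N]
  have key := symmetric_sub_le hm (fun x => ∑ τ : Equiv.Perm ι, φ (x ∘ τ))
    (fun x => ∑ τ : Equiv.Perm ι, D (x ∘ τ) ∘ₗ LinearMap.funLeft ℝ ℝ τ)
    (h := h) (η := N * η) (L := N * L) hh
    (by
      intro x w hx hxw hw
      have : h * (N * η) = ∑ _τ : Equiv.Perm ι, h * η := by rw [hconst]; ring
      simp only [LinearMap.sum_apply, LinearMap.comp_apply]
      rw [this, ← Finset.sum_sub_distrib, ← Finset.sum_sub_distrib]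
      refine (Finset.abs_sum_le_sum_abs _ _).trans (Finset.sum_le_sum fun τ _ => ?_)
      exact hT (x ∘ τ) (w ∘ τ) ((hnorm _ _).trans hx) ((hnorm τ (x + w)).trans hxw)
        ((hnorm _ _).trans hw))
    (by
      intro x w hx hw
      simp only [LinearMap.sum_apply, LinearMap.comp_apply]
      rw [← hconst]
      refine (Finset.abs_sum_le_sum_abs _ _).trans (Finset.sum_le_sum fun τ _ => ?_)
      exact hL (x ∘ τ) (w ∘ τ) ((hnorm _ _).trans hx) ((hnorm _ _).trans hw))
    (by
      intro σ x w
      simp only [LinearMap.sum_apply, LinearMap.comp_apply]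
      exact Fintype.sum_equiv (Equiv.mulLeft σ) _ _ fun τ => rfl)
  have hlow : N * (3 * (p * (h * η)) + p * (h * (L / m))) <
      ∑ τ : Equiv.Perm ι, φ ((Pi.single none (p * h) : ι → ℝ) ∘ τ) -
        ∑ τ : Equiv.Perm ι, φ ((0 : ι → ℝ) ∘ τ) := by
    rw [← hconst, ← Finset.sum_sub_distrib]
    refine Finset.sum_lt_sum_of_nonempty ⟨1, Finset.mem_univ _⟩ fun τ _ => ?_
    have h1 : (Pi.single none (p * h) : ι → ℝ) ∘ τ = Pi.single (τ.symm none) (p * h) := by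
      funext i
      simp only [Function.comp_apply, Pi.single_apply, Equiv.eq_symm_apply]
    rw [h1]
    exact hcon (τ.symm none)
  refine absurd (hlow.trans_le key) (not_lt.2 (le_of_eq ?_))
  field_simp

/-- The Banach space `ℓ∞(Γ)`. -/
abbrev LInf (Γ : Type*) := lp (fun _ : Γ => ℝ) ⊤

namespace LInf

variable {Γ : Type*}

/-- The indicator function of a set, as an element of `ℓ∞(Γ)`. -/
noncomputable def ind (B : Set Γ) : LInf Γ :=
  ⟨B.indicator 1, memℓp_infty ⟨1, by
    rintro _ ⟨γ, rfl⟩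
    by_cases h : γ ∈ B <;> simp [h]⟩⟩

theorem ind_of_mem {B : Set Γ} {γ : Γ} (h : γ ∈ B) : (ind B : LInf Γ) γ = 1 :=
  Set.indicator_of_mem h _

theorem ind_of_notMem {B : Set Γ} {γ : Γ} (h : γ ∉ B) : (ind B : LInf Γ) γ = 0 :=
  Set.indicator_of_notMem h _

theorem ind_singleton [DecidableEq Γ] (γ : Γ) : ind {γ} = (lp.single ⊤ γ 1 : LInf Γ) := by
  ext β
  by_cases h : β = γ
  · subst h
    rw [ind_of_mem (Set.mem_singleton β), lp.single_apply_self]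
  · rw [ind_of_notMem (fun h' => h (Set.mem_singleton_iff.1 h')), lp.single_apply_ne _ _ _ h]

theorem norm_apply_le (v : LInf Γ) (γ : Γ) : |v γ| ≤ ‖v‖ :=
  lp.norm_apply_le_norm ENNReal.top_ne_zero v γ

theorem norm_ind_le (B : Set Γ) : ‖(ind B : LInf Γ)‖ ≤ 1 :=
  lp.norm_le_of_forall_le zero_le_one fun γ => by
    by_cases h : γ ∈ B
    · simp [ind_of_mem h]
    · simp [ind_of_notMem h]

theorem norm_smul_ind_le {c : ℝ} (hc : 0 ≤ c) (B : Set Γ) : ‖c • (ind B : LInf Γ)‖ ≤ c := by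
  rw [norm_smul, Real.norm_of_nonneg hc]
  exact mul_le_of_le_one_right hc (norm_ind_le B)

theorem norm_sum_le_of_disjoint {ι : Type*} (s : Finset ι) (v : ι → LInf Γ) (C : ι → Set Γ)
    (hC : Pairwise (Function.onFun Disjoint C)) (hv : ∀ i, ∀ γ ∉ C i, v i γ = 0) {r : ℝ}
    (hr : 0 ≤ r) (hvr : ∀ i, ‖v i‖ ≤ r) : ‖∑ i ∈ s, v i‖ ≤ r := by
  refine lp.norm_le_of_forall_le hr fun γ => ?_
  rw [lp.coeFn_sum, Finset.sum_apply]
  by_cases h : ∃ i ∈ s, γ ∈ C i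
  · obtain ⟨i, hi, hγ⟩ := h
    rw [Finset.sum_eq_single_of_mem i hi fun j _ hj =>
      hv j γ fun hγ' => Set.disjoint_left.1 (hC hj) hγ' hγ]
    exact (norm_apply_le _ _).trans (hvr i)
  · push Not at h
    rw [Finset.sum_eq_zero fun i hi => hv i γ (h i hi), norm_zero]
    exact hr

theorem norm_add_le_of_disjoint {y z : LInf Γ} (h : ∀ γ, y γ = 0 ∨ z γ = 0) {r : ℝ}
    (hy : ‖y‖ ≤ r) (hz : ‖z‖ ≤ r) : ‖y + z‖ ≤ r := by
  refine lp.norm_le_of_forall_le ((norm_nonneg y).trans hy) fun γ => ?_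
  rw [lp.coeFn_add, Pi.add_apply]
  rcases h γ with h | h
  · rw [h, zero_add]; exact (norm_apply_le z γ).trans hz
  · rw [h, add_zero]; exact (norm_apply_le y γ).trans hy

/-- A uniformly smooth real function on the ball of `ℓ∞(Γ)` changes by at least `ε` in the direction
of only finitely many members of a disjoint family. -/
theorem finite_setOf_le_sub {f : LInf Γ → ℝ} {f' : LInf Γ → LInf Γ →L[ℝ] ℝ} {L : ℝ}
    (hL : ∀ x ∈ ball (0 : LInf Γ) 1, ‖f' x‖ ≤ L)
    (hT : ∀ η > 0, ∃ ρ > 0, ∀ x ∈ ball (0 : LInf Γ) 1, ∀ w, x + w ∈ ball (0 : LInf Γ) 1 →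
      ‖w‖ ≤ ρ → |f (x + w) - f x - f' x w| ≤ η * ‖w‖)
    {y : LInf Γ} {r t : ℝ} (hr : r < 1) (hy : ‖y‖ ≤ r) (ht : 0 ≤ t) (htr : t ≤ r)
    {𝓢 : Set (Set Γ)} (h𝓢 : 𝓢.PairwiseDisjoint id) (hy𝓢 : ∀ B ∈ 𝓢, ∀ γ ∈ B, y γ = 0)
    {ε : ℝ} (hε : 0 < ε) : {B ∈ 𝓢 | ε ≤ f (y + t • ind B) - f y}.Finite := by
  by_contra hinf
  have hL0 : 0 ≤ L := (norm_nonneg _).trans (hL 0 (mem_ball_self one_pos))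
  obtain ⟨ρ, hρ, hρT⟩ := hT (ε / 6) (by positivity)
  obtain ⟨p, hp⟩ := exists_nat_gt (t / ρ)
  obtain ⟨m, hm⟩ := exists_nat_gt (2 * L / ε)
  have hp0 : (0 : ℝ) < p := (by positivity : 0 ≤ t / ρ).trans_lt hp
  have hm0 : (0 : ℝ) < m := (by positivity : 0 ≤ 2 * L / ε).trans_lt hm
  have hph : (p : ℝ) * (t / p) = t := by field_simp
  have htρ : t / p ≤ ρ := by
    rw [div_lt_iff₀ hρ] at hp
    rw [div_le_iff₀ hp0]; linarith
  let ι := Option ((Fin p → SignType) × Fin m)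
  obtain ⟨g, hg⟩ : ∃ g : ι → {B ∈ 𝓢 | ε ≤ f (y + t • ind B) - f y}, Function.Injective g := by
    have : Infinite {B ∈ 𝓢 | ε ≤ f (y + t • ind B) - f y} := Set.infinite_coe_iff.2 hinf
    exact ⟨_, ((Fintype.equivFin ι).toEmbedding.trans
      (Fin.valEmbedding.trans (Infinite.natEmbedding _))).injective⟩
  let B : ι → Set Γ := fun i => (g i).1
  have hB : Pairwise (Function.onFun Disjoint B) := fun i j hij =>
    h𝓢 (g i).2.1 (g j).2.1 fun h => hij (hg (Subtype.ext h))
  let J : (ι → ℝ) →ₗ[ℝ] LInf Γ := Fintype.linearCombination ℝ fun i => ind (B i)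
  have hJ : ∀ x, J x = ∑ i, x i • ind (B i) := fun x => Fintype.linearCombination_apply _ _ _
  have hJnorm : ∀ x, ‖J x‖ ≤ ‖x‖ := by
    intro x
    rw [hJ]
    refine norm_sum_le_of_disjoint _ _ B hB (fun i γ hγ => ?_) (norm_nonneg x) fun i => ?_
    · rw [lp.coeFn_smul, Pi.smul_apply, ind_of_notMem hγ, smul_zero]
    · rw [norm_smul]
      exact (mul_le_of_le_one_right (norm_nonneg _) (norm_ind_le _)).trans (norm_le_pi_norm x i)
  have hJball : ∀ x, ‖x‖ ≤ t → y + J x ∈ ball (0 : LInf Γ) 1 := by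
    intro x hx
    rw [mem_ball_zero_iff]
    refine (norm_add_le_of_disjoint (fun γ => ?_) hy ((hJnorm x).trans (hx.trans htr))).trans_lt hr
    by_cases h : ∃ i, γ ∈ B i
    · obtain ⟨i, hi⟩ := h
      exact Or.inl (hy𝓢 _ (g i).2.1 γ hi)
    · push Not at h
      right
      rw [hJ, lp.coeFn_sum, Finset.sum_apply]
      refine Finset.sum_eq_zero fun i _ => ?_
      rw [lp.coeFn_smul, Pi.smul_apply, ind_of_notMem (h i), smul_zero]
  obtain ⟨i, hi⟩ := exists_single_sub_le (by exact_mod_cast hm0) (fun x => f (y + J x))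
    (fun x => (f' (y + J x)).toLinearMap ∘ₗ J) (h := t / p) (η := ε / 6) (L := L) (by positivity)
    (by
      rw [hph]
      intro x w hx hxw hw
      have h1 := hρT (y + J x) (hJball x hx) (J w)
        (by rw [add_assoc, ← map_add]; exact hJball _ hxw) ((hJnorm w).trans (hw.trans htρ))
      rw [add_assoc, ← map_add] at h1
      refine h1.trans ?_
      rw [mul_comm]
      exact mul_le_mul_of_nonneg_right ((hJnorm w).trans hw) (by positivity))
    (by
      rw [hph]
      intro x w hx hw
      exact ((f' (y + J x)).le_of_opNorm_le_of_le (hL _ (hJball x hx))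
        ((hJnorm w).trans hw)).trans (by simp))
  have hJi : J (Pi.single i t) = t • ind (B i) := by
    rw [hJ, Finset.sum_eq_single i]
    · rw [Pi.single_eq_same]
    · intro j _ hj
      rw [Pi.single_eq_of_ne hj, zero_smul]
    · exact fun h => absurd (Finset.mem_univ i) h
  have h1 := (g i).2.2
  have h2 : L / m < ε / 2 := by
    rw [div_lt_iff₀ hε] at hm
    rw [div_lt_iff₀ hm0]; linarith
  have h3 : 3 * (p * (t / p * (ε / 6))) + p * (t / p * (L / m)) = t * (ε / 2 + L / m) := by
    field_simp; ring
  rw [h3, hph, hJi, map_zero, add_zero] at hi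
  have h4 : t * (ε / 2 + L / m) ≤ 1 * (ε / 2 + L / m) := by
    gcongr; linarith
  change ε ≤ f (y + t • ind (B i)) - f y at h1
  linarith

theorem finite_setOf_le_abs_sub {f : LInf Γ → ℝ} {f' : LInf Γ → LInf Γ →L[ℝ] ℝ} {L : ℝ}
    (hL : ∀ x ∈ ball (0 : LInf Γ) 1, ‖f' x‖ ≤ L)
    (hT : ∀ η > 0, ∃ ρ > 0, ∀ x ∈ ball (0 : LInf Γ) 1, ∀ w, x + w ∈ ball (0 : LInf Γ) 1 →
      ‖w‖ ≤ ρ → |f (x + w) - f x - f' x w| ≤ η * ‖w‖)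
    {y : LInf Γ} {r t : ℝ} (hr : r < 1) (hy : ‖y‖ ≤ r) (ht : 0 ≤ t) (htr : t ≤ r)
    {𝓢 : Set (Set Γ)} (h𝓢 : 𝓢.PairwiseDisjoint id) (hy𝓢 : ∀ B ∈ 𝓢, ∀ γ ∈ B, y γ = 0)
    {ε : ℝ} (hε : 0 < ε) : {B ∈ 𝓢 | ε ≤ |f (y + t • ind B) - f y|}.Finite := by
  have h1 := finite_setOf_le_sub hL hT hr hy ht htr h𝓢 hy𝓢 hε
  have h2 := finite_setOf_le_sub (f := fun x => -f x) (f' := fun x => -f' x) (L := L)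
    (fun x hx => by rw [norm_neg]; exact hL x hx)
    (fun η hη => by
      obtain ⟨ρ, hρ, h⟩ := hT η hη
      refine ⟨ρ, hρ, fun x hx w hxw hw => ?_⟩
      have := h x hx w hxw hw
      rw [← abs_neg] at this
      convert this using 2
      simp; ring) hr hy ht htr h𝓢 hy𝓢 hε
  refine (h1.union h2).subset fun B hB => ?_
  rcases le_abs.1 hB.2 with h | h
  · exact Or.inl ⟨hB.1, h⟩
  · exact Or.inr ⟨hB.1, by linarith⟩

end LInf

namespace LInf

open Cardinal in
/-- **Rosenthal's theorem**, in the weak form: an operator on `ℓ∞(Γ)` that is bounded below on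
sufficiently many unit vectors is bounded below on `ℓ∞(A)` for some `A` of size `κ`. -/
theorem exists_bounded_below {Γ : Type u} {X : Type v} [NormedAddCommGroup X] [NormedSpace ℝ X]
    (T : LInf Γ →L[ℝ] X) (S : Set Γ) (κ : Cardinal.{u}) (hκ : ℵ₀ ≤ κ) (hS : Order.succ κ < #S)
    {δ : ℝ} (hδ : 0 < δ) (hT : ∀ γ ∈ S, δ ≤ ‖T (ind {γ})‖) :
    ∃ A ⊆ S, #A = κ ∧ ∀ v : LInf Γ, (∀ γ ∉ A, v γ = 0) → δ / 2 * ‖v‖ ≤ ‖T v‖ := by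
  choose φ hφ1 hφ2 using fun γ => exists_dual_vector'' ℝ (T (ind {γ}))
  have hφT : ∀ γ v, |φ γ (T v)| ≤ ‖T v‖ := fun γ v =>
    ((φ γ).le_of_opNorm_le (hφ1 γ) _).trans (by rw [one_mul])
  obtain ⟨A, hAS, hA, hgood⟩ := exists_subset_forall_diff_singleton_notMem S κ hκ hS
    (fun γ => {B | ∃ v : LInf Γ, ‖v‖ ≤ 1 ∧ (∀ β ∉ B, v β = 0) ∧ δ / 2 < φ γ (T v)}) (by
      intro γ 𝓢 h𝓢 hdisj
      by_contra hinf
      obtain ⟨n, hn⟩ := exists_nat_gt (‖T‖ / (δ / 2))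
      have : Infinite 𝓢 := Set.infinite_coe_iff.2 hinf
      let g : ℕ ↪ 𝓢 := Infinite.natEmbedding _
      choose v hv1 hv2 hv3 using fun i => h𝓢 (g i).2
      have hB : Pairwise (Function.onFun Disjoint fun i => (g i).1) := fun i j hij =>
        hdisj (g i).2 (g j).2 fun h => hij (g.injective (Subtype.ext h))
      have h1 : ‖∑ i ∈ Finset.range n, v i‖ ≤ 1 :=
        norm_sum_le_of_disjoint _ v (fun i => (g i).1) hB hv2 zero_le_one hv1
      have h2 : n * (δ / 2) ≤ φ γ (T (∑ i ∈ Finset.range n, v i)) := by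
        rw [map_sum, map_sum]
        calc (n : ℝ) * (δ / 2) = ∑ i ∈ Finset.range n, δ / 2 := by simp
          _ ≤ _ := Finset.sum_le_sum fun i _ => (hv3 i).le
      have h3 : φ γ (T (∑ i ∈ Finset.range n, v i)) ≤ ‖T‖ :=
        (le_abs_self _).trans ((hφT _ _).trans ((T.le_opNorm_of_le h1).trans (by rw [mul_one])))
      rw [div_lt_iff₀ (by positivity)] at hn
      linarith)
  refine ⟨A, hAS, hA, fun v hv => ?_⟩
  have hsmall : ∀ γ ∈ A, ∀ w : LInf Γ, (∀ β ∉ A \ {γ}, w β = 0) →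
      |φ γ (T w)| ≤ δ / 2 * ‖w‖ := by
    have key : ∀ γ ∈ A, ∀ w : LInf Γ, (∀ β ∉ A \ {γ}, w β = 0) → φ γ (T w) ≤ δ / 2 * ‖w‖ := by
      intro γ hγ w hw
      rcases eq_or_ne w 0 with rfl | hw0
      · simp
      · have hpos : 0 < ‖w‖ := norm_pos_iff.2 hw0
        by_contra! hlt
        refine hgood γ hγ ⟨‖w‖⁻¹ • w, ?_, fun β hβ => ?_, ?_⟩
        · rw [norm_smul, norm_inv, norm_norm, inv_mul_cancel₀ hpos.ne']
        · rw [lp.coeFn_smul, Pi.smul_apply, hw β hβ, smul_zero]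
        · rw [map_smul, map_smul, smul_eq_mul, ← div_eq_inv_mul, lt_div_iff₀ hpos]
          exact hlt
    intro γ hγ w hw
    refine abs_le'.2 ⟨key γ hγ w hw, ?_⟩
    have := key γ hγ (-w) fun β hβ => by rw [lp.coeFn_neg, Pi.neg_apply, hw β hβ, neg_zero]
    rwa [map_neg, map_neg, norm_neg] at this
  have hpt : ∀ γ ∈ A, δ * |v γ| ≤ ‖T v‖ + δ / 2 * ‖v‖ := by
    intro γ hγ
    let w : LInf Γ := v - v γ • ind {γ}
    have hwγ : w γ = 0 := by
      rw [lp.coeFn_sub, Pi.sub_apply, lp.coeFn_smul, Pi.smul_apply,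
        ind_of_mem (Set.mem_singleton γ)]
      simp
    have hwβ : ∀ β ≠ γ, w β = v β := fun β hβ => by
      rw [lp.coeFn_sub, Pi.sub_apply, lp.coeFn_smul, Pi.smul_apply,
        ind_of_notMem (fun h => hβ (Set.mem_singleton_iff.1 h))]
      simp
    have hw : ‖w‖ ≤ ‖v‖ := lp.norm_le_of_forall_le (norm_nonneg v) fun β => by
      rcases eq_or_ne β γ with rfl | hβ
      · rw [hwγ, norm_zero]; exact norm_nonneg v
      · rw [hwβ β hβ]; exact norm_apply_le v β
    have h1 := hsmall γ hγ w fun β hβ => by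
      rcases eq_or_ne β γ with rfl | hne
      · exact hwγ
      · rw [hwβ β hne]
        exact hv β fun h => hβ ⟨h, hne⟩
    have h2 : φ γ (T v) = φ γ (T w) + v γ * ‖T (ind {γ})‖ := by
      have h3 : v = w + v γ • ind {γ} := by simp [w]
      conv_lhs => rw [h3]
      rw [map_add, map_add, map_smul, map_smul, hφ2, smul_eq_mul]
      rfl
    have h3 : |v γ| * δ ≤ |v γ * ‖T (ind {γ})‖| := by
      rw [abs_mul, abs_norm]
      exact mul_le_mul_of_nonneg_left (hT γ (hAS hγ)) (abs_nonneg _)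
    have h4 : v γ * ‖T (ind {γ})‖ = φ γ (T v) - φ γ (T w) := by linarith
    rw [h4] at h3
    have h5 := abs_sub (φ γ (T v)) (φ γ (T w))
    have h6 := hφT γ v
    have h7 : δ / 2 * ‖w‖ ≤ δ / 2 * ‖v‖ := by gcongr
    linarith
  have hnorm : ‖v‖ ≤ (‖T v‖ + δ / 2 * ‖v‖) / δ := by
    refine lp.norm_le_of_forall_le (by positivity) fun γ => ?_
    by_cases hγ : γ ∈ A
    · rw [le_div_iff₀ hδ, mul_comm]
      exact hpt γ hγ
    · rw [hv γ hγ, norm_zero]; positivity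
  rw [le_div_iff₀ hδ] at hnorm
  linarith

/-- Extension by zero along an injection, as an isometric embedding of `ℓ∞` spaces. -/
noncomputable def extendₗᵢ {Λ Γ : Type*} (e : Λ → Γ) (he : Function.Injective e) :
    LInf Λ →ₗᵢ[ℝ] LInf Γ where
  toFun v := ⟨Function.extend e v 0, memℓp_infty ⟨‖v‖, by
    rintro _ ⟨γ, rfl⟩
    by_cases h : ∃ a, e a = γ
    · obtain ⟨a, rfl⟩ := h
      simpa [he.extend_apply] using norm_apply_le v a
    · simp [Function.extend_apply' _ _ _ h]⟩⟩
  map_add' v w := by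
    ext γ
    change Function.extend e (⇑v + ⇑w : Λ → ℝ) 0 γ = Function.extend e v 0 γ + Function.extend e w 0 γ
    by_cases h : ∃ a, e a = γ
    · obtain ⟨a, rfl⟩ := h
      simp only [he.extend_apply, Pi.add_apply]
    · simp only [Function.extend_apply' _ _ _ h, Pi.zero_apply, add_zero]
  map_smul' c v := by
    ext γ
    change Function.extend e (c • ⇑v) 0 γ = c * Function.extend e v 0 γ
    by_cases h : ∃ a, e a = γ
    · obtain ⟨a, rfl⟩ := h
      simp [he.extend_apply]
    · simp [Function.extend_apply' _ _ _ h]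
  norm_map' v := by
    refine le_antisymm (lp.norm_le_of_forall_le (norm_nonneg v) fun γ => ?_)
      (lp.norm_le_of_forall_le (norm_nonneg _) fun a => ?_)
    · change ‖Function.extend e v 0 γ‖ ≤ _
      by_cases h : ∃ a, e a = γ
      · obtain ⟨a, rfl⟩ := h
        rw [he.extend_apply]; exact norm_apply_le v a
      · simp [Function.extend_apply' _ _ _ h]
    · refine le_trans (le_of_eq ?_) (norm_apply_le _ (e a))
      change _ = |Function.extend e v 0 (e a)|
      rw [he.extend_apply]; rfl

theorem extendₗᵢ_apply_of_notMem {Λ Γ : Type*} (e : Λ → Γ) (he : Function.Injective e) (v : LInf Λ)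
    {γ : Γ} (h : γ ∉ Set.range e) : extendₗᵢ e he v γ = 0 :=
  Function.extend_apply' _ _ _ h

end LInf

theorem exists_norm_le_of_uniformContinuousOn_ball {V W : Type*} [NormedAddCommGroup V]
    [NormedSpace ℝ V] [NormedAddCommGroup W] {g : V → W} (hg : UniformContinuousOn g (ball 0 1)) :
    ∃ L, ∀ x ∈ ball (0 : V) 1, ‖g x‖ ≤ L := by
  obtain ⟨ρ, hρ, h⟩ := Metric.uniformContinuousOn_iff.1 hg 1 one_pos
  obtain ⟨n, hn⟩ := exists_nat_gt (1 / ρ)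
  have hn0 : (0 : ℝ) < n := (by positivity : 0 ≤ 1 / ρ).trans_lt hn
  refine ⟨‖g 0‖ + n, fun x hx => ?_⟩
  rw [mem_ball_zero_iff] at hx
  have hmem : ∀ k ≤ n, ((k : ℝ) / n) • x ∈ ball (0 : V) 1 := fun k hk => by
    rw [mem_ball_zero_iff, norm_smul, Real.norm_of_nonneg (by positivity)]
    refine lt_of_le_of_lt (mul_le_of_le_one_left (norm_nonneg x) ?_) hx
    rw [div_le_one hn0]
    exact_mod_cast hk
  have key : ∀ k ≤ n, ‖g (((k : ℝ) / n) • x)‖ ≤ ‖g 0‖ + k := by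
    intro k
    induction k with
    | zero => intro _; simp
    | succ k ih =>
      intro hk
      have h1 := h _ (hmem (k + 1) hk) _ (hmem k (by omega)) (by
        rw [dist_eq_norm, ← sub_smul, norm_smul]
        have : (((k + 1 : ℕ) : ℝ) / n - k / n) = 1 / n := by push_cast; field_simp; ring
        rw [this, Real.norm_of_nonneg (by positivity)]
        refine (mul_le_of_le_one_right (by positivity) hx.le).trans_lt ?_
        rw [div_lt_iff₀ hρ] at hn
        rw [div_lt_iff₀ hn0]; linarith)
      rw [dist_eq_norm] at h1
      have h2 := ih (by omega)
      have h3 := norm_sub_norm_le (g (((k + 1 : ℕ) / n : ℝ) • x)) (g ((k / n : ℝ) • x))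
      push_cast at *
      linarith
  have := key n le_rfl
  rwa [div_self hn0.ne', one_smul] at this

/-- A first-order Taylor estimate, uniform up to the boundary of the ball. -/
theorem exists_forall_norm_sub_sub_le {V X : Type*} [NormedAddCommGroup V] [NormedSpace ℝ V]
    [NormedAddCommGroup X] [NormedSpace ℝ X] {F : V → X} {F' : V → V →L[ℝ] X}
    (hFcont : ContinuousOn F (closedBall 0 1)) (hFderiv : ∀ x ∈ ball (0 : V) 1, HasFDerivAt F (F' x) x)
    (hF'unif : UniformContinuousOn F' (ball 0 1)) {η : ℝ} (hη : 0 < η) :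
    ∃ ρ > 0, ∀ x ∈ ball (0 : V) 1, ∀ y ∈ closedBall (0 : V) 1, ‖y - x‖ < ρ →
      ‖F y - F x - F' x (y - x)‖ ≤ η * ‖y - x‖ := by
  obtain ⟨ρ, hρ, h⟩ := Metric.uniformContinuousOn_iff.1 hF'unif η hη
  refine ⟨ρ, hρ, fun x hx y hy hyx => ?_⟩
  have hopen : ∀ z ∈ ball x ρ ∩ ball 0 1, ‖F z - F x - F' x (z - x)‖ ≤ η * ‖z - x‖ := fun z hz =>
    ((convex_ball x ρ).inter (convex_ball 0 1)).norm_image_sub_le_of_norm_hasFDerivWithin_le'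
      (fun w hw => (hFderiv w hw.2).hasFDerivWithinAt)
      (fun w hw => by
        have := h w hw.2 x hx hw.1
        rw [dist_eq_norm] at this
        exact this.le)
      ⟨mem_ball_self hρ, hx⟩ hz
  have hsub : ball x ρ ∩ ball 0 1 ⊆ closedBall (0 : V) 1 :=
    Set.inter_subset_right.trans ball_subset_closedBall
  have hcl : y ∈ closure (ball x ρ ∩ ball 0 1) :=
    isOpen_ball.inter_closure ⟨by rwa [mem_ball, dist_eq_norm], by
      rwa [closure_ball (0 : V) one_ne_zero]⟩
  have hFy : ContinuousWithinAt F (ball x ρ ∩ ball 0 1) y := (hFcont y hy).mono hsub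
  refine ContinuousWithinAt.closure_le hcl ?_ ?_ hopen
  · refine ((hFy.sub continuousWithinAt_const).sub ?_).norm
    exact Continuous.continuousWithinAt (by fun_prop)
  · exact Continuous.continuousWithinAt (by fun_prop)

namespace LInf

theorem ind_eq_add {Γ : Type*} {A : Set Γ} {γ : Γ} (hγ : γ ∈ A) :
    (ind A : LInf Γ) = ind {γ} + ind (A \ {γ}) := by
  ext β
  rw [lp.coeFn_add, Pi.add_apply]
  by_cases h : β = γ
  · subst h
    rw [ind_of_mem hγ, ind_of_mem (Set.mem_singleton β), ind_of_notMem fun h => h.2 rfl, add_zero]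
  · have h' : β ∉ ({γ} : Set Γ) := h
    rw [ind_of_notMem h', zero_add]
    by_cases hA : β ∈ A
    · rw [ind_of_mem hA, ind_of_mem (Set.mem_sdiff_of_mem hA h')]
    · rw [ind_of_notMem hA, ind_of_notMem fun h => hA h.1]

open Cardinal in
theorem exists_derivative_bounded_below_on_singletons {Γ : Type u} {X : Type v}
    [NormedAddCommGroup X] [NormedSpace ℝ X] {F : LInf Γ → X} {F' : LInf Γ → LInf Γ →L[ℝ] X}
    (hFcont : ContinuousOn F (closedBall 0 1))
    (hFderiv : ∀ x ∈ ball (0 : LInf Γ) 1, HasFDerivAt F (F' x) x)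
    (hF'unif : UniformContinuousOn F' (ball 0 1)) {δ : ℝ} (hδ : 0 < δ)
    (hF : ∀ γ, δ ≤ ‖F (ind {γ}) - F 0‖) {κ : Cardinal.{u}} (hκ : ℵ₀ ≤ κ)
    (hΓ : Order.succ (Order.succ κ) ≤ #Γ) :
    ∃ x ∈ ball (0 : LInf Γ) 1, ∃ A : Set Γ, #A = κ ∧ ∀ γ ∈ A, δ / 2 ≤ ‖F' x (ind {γ})‖ := by
  obtain ⟨L, hL⟩ := exists_norm_le_of_uniformContinuousOn_ball hF'unif
  have hL0 : 0 ≤ L := (norm_nonneg _).trans (hL 0 (mem_ball_self one_pos))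
  have hη : 0 < δ / 10 := by positivity
  obtain ⟨ρ, hρ, hT⟩ := exists_forall_norm_sub_sub_le hFcont hFderiv hF'unif hη
  obtain ⟨n, hn⟩ := exists_nat_gt (1 / ρ)
  have hn0 : (0 : ℝ) < n := (by positivity : 0 ≤ 1 / ρ).trans_lt hn
  have hnρ : 1 / (n : ℝ) < ρ := by
    rw [div_lt_iff₀ hρ] at hn
    rw [div_lt_iff₀ hn0]; linarith
  have hk : ∀ γ, ∃ k : ULift.{u} (Fin n),
      δ - δ / 10 ≤ ‖F' (((k.down : ℕ) / n : ℝ) • ind {γ}) (ind {γ})‖ := by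
    intro γ
    obtain ⟨k, hkn, hk⟩ : ∃ k ∈ Finset.range n, δ / n ≤
        ‖F (((k + 1 : ℕ) / n : ℝ) • ind {γ}) - F (((k : ℕ) / n : ℝ) • ind {γ})‖ := by
      by_contra! hcon
      have h1 := Finset.sum_lt_sum_of_nonempty
        (Finset.nonempty_range_iff.2 (by rintro rfl; simp at hn0)) hcon
      have h2 := norm_sum_le (Finset.range n) fun k : ℕ =>
        F (((k + 1 : ℕ) / n : ℝ) • ind {γ}) - F (((k : ℕ) / n : ℝ) • ind {γ})
      rw [Finset.sum_range_sub (fun k : ℕ => F (((k : ℕ) / n : ℝ) • ind {γ})), div_self hn0.ne',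
        Nat.cast_zero, zero_div, zero_smul, one_smul] at h2
      rw [Finset.sum_const, Finset.card_range, nsmul_eq_mul, mul_div_cancel₀ _ hn0.ne'] at h1
      linarith [hF γ]
    rw [Finset.mem_range] at hkn
    refine ⟨⟨k, hkn⟩, ?_⟩
    have hkn' : (k : ℝ) + 1 ≤ n := by exact_mod_cast hkn
    have hdiff : (((k + 1 : ℕ) / n : ℝ) • ind {γ} - ((k : ℕ) / n : ℝ) • ind {γ} : LInf Γ) =
        (1 / n : ℝ) • ind {γ} := by
      rw [← sub_smul]; congr 1; push_cast; field_simp; ring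
    have hsmall : ‖((1 / n : ℝ) • ind {γ} : LInf Γ)‖ ≤ 1 / n :=
      norm_smul_ind_le (by positivity) _
    have h1 := hT (((k : ℕ) / n : ℝ) • ind {γ})
      (mem_ball_zero_iff.2 ((norm_smul_ind_le (by positivity) _).trans_lt
        ((div_lt_one hn0).2 (by linarith))))
      (((k + 1 : ℕ) / n : ℝ) • ind {γ})
      (mem_closedBall_zero_iff.2 ((norm_smul_ind_le (by positivity) _).trans
        ((div_le_one hn0).2 (by push_cast; linarith))))
      (by rw [hdiff]; exact hsmall.trans_lt hnρ)
    rw [hdiff, map_smul] at h1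
    have h2 := norm_sub_norm_le (F (((k + 1 : ℕ) / n : ℝ) • ind {γ}) -
      F (((k : ℕ) / n : ℝ) • ind {γ})) ((1 / n : ℝ) • F' (((k : ℕ) / n : ℝ) • ind {γ}) (ind {γ}))
    rw [norm_smul, Real.norm_of_nonneg (by positivity)] at h2
    have h3 : δ / 10 * ‖((1 / n : ℝ) • ind {γ} : LInf Γ)‖ ≤ δ / 10 * (1 / n) := by gcongr
    have h4 : (δ - δ / 10) / n ≤ ‖F' (((k : ℕ) / n : ℝ) • ind {γ}) (ind {γ})‖ / n := by
      rw [sub_div, div_eq_mul_one_div (δ / 10), div_eq_mul_one_div ‖_‖]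
      linarith
    exact (div_le_div_iff_of_pos_right hn0).1 h4
  choose k hk using hk
  have hκ1 : ℵ₀ ≤ Order.succ κ := hκ.trans (Order.le_succ κ)
  obtain ⟨k₀, hk₀⟩ := infinite_pigeonhole_card k (Order.succ (Order.succ κ)) hΓ
    (hκ1.trans (Order.le_succ _)) (by
      rw [(isRegular_succ hκ1).cof_ord]
      exact (lt_aleph0_of_finite _).trans_le (hκ1.trans (Order.le_succ _)))
  set t : ℝ := (k₀.down : ℕ) / n with ht
  have ht0 : 0 ≤ t := by positivity
  have ht1 : t < 1 := (div_lt_one hn0).2 (by exact_mod_cast k₀.down.2)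
  let s : ℝ := min (ρ / 2) ((1 - t) / 2)
  have hs0 : 0 < s := lt_min (by positivity) (by linarith)
  have hsρ : s < ρ := (min_le_left _ _).trans_lt (by linarith)
  have hs1 : t + s < 1 := by linarith [min_le_right (ρ / 2) ((1 - t) / 2)]
  choose φ hφ1 hφ2 using fun γ => exists_dual_vector'' ℝ (F' (t • ind {γ}) (ind {γ}))
  have hφle : ∀ γ z, |φ γ z| ≤ ‖z‖ := fun γ z =>
    ((φ γ).le_of_opNorm_le (hφ1 γ) _).trans (by rw [one_mul])
  have hfin : ∀ γ, ∀ c, 0 ≤ c → c ≤ t + s → ∀ 𝓢 : Set (Set Γ), 𝓢.PairwiseDisjoint id →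
      (∀ B ∈ 𝓢, γ ∉ B) → {B ∈ 𝓢 | s * (δ / 10) ≤
        |φ γ (F (c • ind {γ} + t • ind B)) - φ γ (F (c • ind {γ}))|}.Finite := by
    intro γ c hc0 hc 𝓢 h𝓢 hγ
    refine finite_setOf_le_abs_sub (f := fun x => φ γ (F x)) (f' := fun x => (φ γ).comp (F' x))
      (L := L) (fun x hx => ?_) (fun η hη => ?_) hs1 ((norm_smul_ind_le hc0 _).trans hc) ht0
      (by linarith) h𝓢 (fun B hB β hβ => ?_) (by positivity)
    · refine ((φ γ).opNorm_comp_le _).trans ?_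
      exact (mul_le_of_le_one_left (norm_nonneg _) (hφ1 γ)).trans (hL x hx)
    · obtain ⟨r, hr, h⟩ := exists_forall_norm_sub_sub_le hFcont hFderiv hF'unif hη
      refine ⟨r / 2, by positivity, fun x hx w hxw hw => ?_⟩
      have h1 := h x hx (x + w) (ball_subset_closedBall hxw)
        (by rw [add_sub_cancel_left]; linarith)
      rw [add_sub_cancel_left] at h1
      refine le_trans ?_ ((hφle γ _).trans h1)
      rw [map_sub, map_sub]; rfl
    · rw [lp.coeFn_smul, Pi.smul_apply, ind_of_notMem, smul_zero]
      rintro rfl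
      exact hγ B hB hβ
  obtain ⟨A, hAS, hA, hgood⟩ := exists_subset_forall_diff_singleton_notMem (k ⁻¹' {k₀}) κ hκ
    ((Order.lt_succ _).trans_le hk₀)
    (fun γ => {B | γ ∉ B ∧ (s * (δ / 10) ≤
        |φ γ (F (t • ind {γ} + t • ind B)) - φ γ (F (t • ind {γ}))| ∨ s * (δ / 10) ≤
        |φ γ (F ((t + s) • ind {γ} + t • ind B)) - φ γ (F ((t + s) • ind {γ}))|)}) (by
      intro γ 𝓢 h𝓢 hdisj
      have hγ : ∀ B ∈ 𝓢, γ ∉ B := fun B hB => (h𝓢 hB).1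
      refine ((hfin γ t ht0 (by linarith) 𝓢 hdisj hγ).union
        (hfin γ (t + s) (by linarith) le_rfl 𝓢 hdisj hγ)).subset fun B hB => ?_
      exact (h𝓢 hB).2.imp (fun h => ⟨hB, h⟩) fun h => ⟨hB, h⟩)
  have hx : ‖(t • ind A : LInf Γ)‖ ≤ t := norm_smul_ind_le ht0 A
  refine ⟨t • ind A, mem_ball_zero_iff.2 (hx.trans_lt ht1), A, hA, fun γ hγ => ?_⟩
  have hB := hgood γ hγ
  simp only [Set.mem_ofPred_eq, not_and, not_or, not_le] at hB
  obtain ⟨hB1, hB2⟩ := hB fun h => h.2 rfl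
  have e1 : t • ind {γ} + t • ind (A \ {γ}) = t • (ind A : LInf Γ) := by
    rw [ind_eq_add hγ, smul_add]
  have e2 : (t + s) • ind {γ} + t • ind (A \ {γ}) = t • (ind A : LInf Γ) + s • ind {γ} := by
    rw [ind_eq_add hγ, smul_add, add_smul]; abel
  rw [e1] at hB1
  rw [e2] at hB2
  have hse : ‖(s • ind {γ} : LInf Γ)‖ ≤ s := norm_smul_ind_le hs0.le _
  have taylor : ∀ z : LInf Γ, ‖z‖ ≤ t →
      |φ γ (F (z + s • ind {γ})) - φ γ (F z) - s * φ γ (F' z (ind {γ}))| ≤ s * (δ / 10) := by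
    intro z hz
    have h1 := hT z (mem_ball_zero_iff.2 (hz.trans_lt ht1)) (z + s • ind {γ})
      (mem_closedBall_zero_iff.2 ((norm_add_le _ _).trans (by linarith)))
      (by rw [add_sub_cancel_left]; linarith)
    rw [add_sub_cancel_left, map_smul] at h1
    have h2 := (hφle γ _).trans h1
    rw [map_sub, map_sub, map_smul, smul_eq_mul] at h2
    refine h2.trans ?_
    rw [mul_comm]; gcongr
  have h1 := taylor (t • ind {γ}) (norm_smul_ind_le ht0 _)
  have h2 := taylor (t • ind A) hx
  have h3 := hk γ
  rw [show k γ = k₀ from hAS hγ, ← ht] at h3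
  rw [← add_smul, hφ2] at h1
  have h4 : s * (δ - δ / 10) ≤ s * ‖F' (t • ind {γ}) (ind {γ})‖ := by gcongr
  have h5 : s * (δ / 2) ≤ s * φ γ (F' (t • ind A) (ind {γ})) := by
    have h1' := (abs_le.1 h1).1
    have h2' := (abs_le.1 h2).2
    have h3' := (abs_lt.1 hB1).2
    have h4' := (abs_lt.1 hB2).1
    simp only [RCLike.ofReal_real_eq_id, id_eq] at h1'
    linarith
  exact (le_of_mul_le_mul_left h5 hs0).trans ((le_abs_self _).trans (hφle γ _))

end LInf

/-- **Corollary (assuming GCH).** Let `Γ` be a singular cardinal and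
`F ∈ C^{1,+}(B_{ℓ∞(Γ)}; X)` with `inf_γ ‖F(e_γ) - F(0)‖ > 0`. Then for every cardinal
`Λ < Γ` there are a point `x` in the open unit ball and a subspace `Y ⊆ ℓ∞(Γ)`
isomorphic to `ℓ∞(Λ)` on which `dF(x)` is bounded below. -/
theorem derivative_bounded_below_on_subspace_of_singular
    (hGCH : ∀ κ : Cardinal.{u}, Cardinal.aleph0 ≤ κ →
      ¬∃ μ : Cardinal.{u}, κ < μ ∧ μ < 2 ^ κ)
    {X : Type v} [NormedAddCommGroup X] [NormedSpace ℝ X] [CompleteSpace X]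
    {Γ : Type u} [DecidableEq Γ]
    (hsing : Cardinal.aleph0 ≤ Cardinal.mk Γ ∧
      (Cardinal.mk Γ).ord.cof < Cardinal.mk Γ)
    (F : lp (fun _ : Γ => ℝ) ⊤ → X)
    (F' : lp (fun _ : Γ => ℝ) ⊤ → (lp (fun _ : Γ => ℝ) ⊤ →L[ℝ] X))
    (hFcont : ContinuousOn F (closedBall 0 1))
    (hFderiv : ∀ x ∈ ball (0 : lp (fun _ : Γ => ℝ) ⊤) 1, HasFDerivAt F (F' x) x)
    (hF'unif : UniformContinuousOn F' (ball 0 1))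
    (hinf : 0 < ⨅ γ : Γ, ‖F (lp.single ⊤ γ 1) - F 0‖) :
    ∀ Λ : Type u, Cardinal.mk Λ < Cardinal.mk Γ →
      ∃ x ∈ ball (0 : lp (fun _ : Γ => ℝ) ⊤) 1,
      ∃ Y : Subspace ℝ (lp (fun _ : Γ => ℝ) ⊤),
        Nonempty (lp (fun _ : Λ => ℝ) ⊤ ≃L[ℝ] Y) ∧
        ∃ l : ℝ, 0 < l ∧ ∀ y ∈ Y, l * ‖y‖ ≤ ‖F' x y‖ := by
  classical
  intro Λ hΛ
  have hsucc : ∀ μ, μ < Cardinal.mk Γ → Order.succ μ < Cardinal.mk Γ := by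
    intro μ hμ
    refine (Order.succ_le_of_lt hμ).lt_of_ne fun h => ?_
    rcases lt_or_ge μ Cardinal.aleph0 with hfin | hinf'
    · exact absurd hsing.1 (h ▸ (Cardinal.isStrongLimit_aleph0.isSuccLimit.succ_lt hfin).not_ge)
    · have := (Cardinal.isRegular_succ hinf').cof_ord
      rw [h] at this
      exact hsing.2.ne this
  have hΓ0 : Cardinal.aleph0 < Cardinal.mk Γ := hsing.1.lt_of_ne fun h => by
    have := Cardinal.isRegular_aleph0.cof_ord
    rw [h] at this
    exact hsing.2.ne this
  let κ := max (Cardinal.mk Λ) Cardinal.aleph0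
  have hκ : Cardinal.aleph0 ≤ κ := le_max_right _ _
  have hκΓ : κ < Cardinal.mk Γ := max_lt hΛ hΓ0
  have hκ1 : Cardinal.aleph0 ≤ Order.succ (Order.succ κ) :=
    hκ.trans ((Order.le_succ _).trans (Order.le_succ _))
  obtain ⟨x, hx, S, hS, hSx⟩ := LInf.exists_derivative_bounded_below_on_singletons hFcont hFderiv
    hF'unif hinf
    (fun γ => by
      rw [LInf.ind_singleton]
      exact ciInf_le ⟨0, by rintro _ ⟨γ, rfl⟩; exact norm_nonneg _⟩ γ) hκ1
    (hsucc _ (hsucc _ (hsucc _ (hsucc _ hκΓ)))).le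
  obtain ⟨A, -, hA, hbelow⟩ := LInf.exists_bounded_below (F' x) S κ hκ
    (by rw [hS]; exact Order.lt_succ _) (half_pos hinf) hSx
  obtain ⟨e⟩ : Nonempty (Λ ↪ A) := by
    have : Cardinal.mk Λ ≤ Cardinal.mk A := hA ▸ le_max_left _ _
    exact this
  let J := LInf.extendₗᵢ (fun a => (e a : Γ)) (Subtype.val_injective.comp e.injective)
  refine ⟨x, hx, LinearMap.range J.toLinearMap, ⟨J.equivRange.toContinuousLinearEquiv⟩, _,
    half_pos (half_pos hinf), ?_⟩
  rintro _ ⟨v, rfl⟩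
  refine hbelow _ fun γ hγ => LInf.extendₗᵢ_apply_of_notMem _ _ v ?_
  rintro ⟨a, rfl⟩
  exact hγ (e a).2
end

section
/- Let ω be a modulus, L > 0, ε > 0, and let Y be a Banach space that does not contain the spaces ℓ∞^m uniformly, i.e., for every constant C ≥ 1 there exists m ∈ ℕ such that Y has no m-dimensional subspace whose Banach–Mazur distance to ℓ∞^m is at most C (by the Maurey–Pisier theorem this is equivalent to Y having non-trivial cotype). Then there is N(ω, L, ε, Y) ∈ ℕ such that if n ≥ N(ω, L, ε, Y) and f : B_{ℓ∞^n} → Y is an L-Lipschitz mapping, continuous on the closed unit ball, Fréchet differentiable on the open unit ball, whose derivative df has modulus of continuity ω, then there exist i ≠ j in {1, …, n} for which ‖f(e_i) − f(e_j)‖ < ε. -/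
open Metric

universe u

/-- A modulus: a non-decreasing function `ω : [0,∞) → [0,∞)` with `ω 0 = 0`,
continuous at `0`. -/
def IsModulus (ω : ℝ → ℝ) : Prop :=
  (∀ t, 0 ≤ t → 0 ≤ ω t) ∧ MonotoneOn ω (Set.Ici 0) ∧ ω 0 = 0 ∧
    ContinuousWithinAt ω (Set.Ici 0) 0

/-- A relation with out-degrees at most `d` on at least `(2 * d + 1) * m` points has an
independent set of size `m`. -/
theorem exists_independent_of_outdegree_le {ι : Type*} (R : ι → ι → Prop) (d : ℕ) :
    ∀ (m : ℕ) (Q : Finset ι), (∀ q ∈ Q, ∀ s ⊆ Q, (∀ r ∈ s, R q r) → s.card ≤ d) →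
      (2 * d + 1) * m ≤ Q.card →
      ∃ s ⊆ Q, s.card = m ∧ ∀ q ∈ s, ∀ r ∈ s, q ≠ r → ¬R q r := by
  classical
  intro m
  induction m with
  | zero => exact fun Q _ _ => ⟨∅, by simp⟩
  | succ m ih =>
    intro Q hd hQ
    have hne : Q.Nonempty := Finset.card_pos.1 (by nlinarith)
    obtain ⟨q, hq, hin⟩ : ∃ q ∈ Q, (Q.filter fun r => R r q).card ≤ d := by
      apply Finset.exists_le_of_sum_le hne
      have := Finset.sum_card_bipartiteAbove_eq_sum_card_bipartiteBelow R (s := Q) (t := Q)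
      simp only [Finset.bipartiteAbove, Finset.bipartiteBelow] at this
      rw [← this]
      exact Finset.sum_le_sum fun r hr => hd r hr _ (Finset.filter_subset _ _) (by simp)
    have hout : (Q.filter fun r => R q r).card ≤ d :=
      hd q hq _ (Finset.filter_subset _ _) (by simp)
    set E : Finset ι := insert q ((Q.filter fun r => R r q) ∪ Q.filter fun r => R q r) with hE
    have hEc : E.card ≤ 2 * d + 1 := by
      have h1 := Finset.card_insert_le q ((Q.filter fun r => R r q) ∪ Q.filter fun r => R q r)
      have h2 := Finset.card_union_le (Q.filter fun r => R r q) (Q.filter fun r => R q r)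
      rw [← hE] at h1
      omega
    have hsd := Finset.le_card_sdiff E Q
    obtain ⟨s, hs, hsm, hind⟩ := ih (Q \ E)
      (fun r hr s hs => hd r (Finset.mem_sdiff.1 hr).1 s (hs.trans Finset.sdiff_subset))
      (by rw [mul_add] at hQ; omega)
    have hmem : ∀ r ∈ s, r ∈ Q ∧ r ≠ q ∧ ¬R r q ∧ ¬R q r := by
      intro r hr
      have := hs hr
      simp only [hE, Finset.mem_sdiff, Finset.mem_insert, Finset.mem_union,
        Finset.mem_filter] at this
      tauto
    refine ⟨insert q s, ?_, ?_, ?_⟩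
    · exact Finset.insert_subset hq (hs.trans Finset.sdiff_subset)
    · rw [Finset.card_insert_of_notMem fun h => (hmem q h).2.1 rfl, hsm]
    · intro a ha b hb hab
      rcases Finset.mem_insert.1 ha with rfl | ha' <;> rcases Finset.mem_insert.1 hb with rfl | hb'
      · exact absurd rfl hab
      · exact (hmem b hb').2.2.2
      · exact (hmem a ha').2.2.1
      · exact hind a ha' b hb' hab

/-- A linear map from `ℓ∞^m` that is bounded by `L` and bounded below by `c` embeds `ℓ∞^m` with
distortion at most `L / c`. -/
theorem exists_subspace_of_bounded_below {Y : Type*} [NormedAddCommGroup Y] [NormedSpace ℝ Y]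
    {m : ℕ} (S : (Fin m → ℝ) →ₗ[ℝ] Y) {L c : ℝ} (hL : 0 ≤ L) (hc : 0 < c)
    (hub : ∀ a, ‖S a‖ ≤ L * ‖a‖) (hlb : ∀ a, c * ‖a‖ ≤ ‖S a‖) :
    ∃ (Z : Subspace ℝ Y) (T : (Fin m → ℝ) ≃L[ℝ] Z),
      ‖(T : (Fin m → ℝ) →L[ℝ] Z)‖ * ‖(T.symm : Z →L[ℝ] (Fin m → ℝ))‖ ≤ L / c := by
  have hinj : Function.Injective S := by
    rw [injective_iff_map_eq_zero]
    intro a ha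
    have := hlb a
    rw [ha, norm_zero] at this
    exact norm_le_zero_iff.1 (by nlinarith [norm_nonneg a])
  refine ⟨LinearMap.range S, (LinearEquiv.ofInjective S hinj).toContinuousLinearEquiv, ?_⟩
  rw [div_eq_mul_inv]
  refine mul_le_mul ?_ ?_ (ContinuousLinearMap.opNorm_nonneg _) hL
  · exact ContinuousLinearMap.opNorm_le_bound _ hL fun a => hub a
  · refine ContinuousLinearMap.opNorm_le_bound _ (by positivity) fun z => ?_
    obtain ⟨a, rfl⟩ := (LinearEquiv.ofInjective S hinj).surjective z
    have h : ‖(LinearEquiv.ofInjective S hinj) a‖ = ‖S a‖ := rfl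
    have h2 := hlb a
    simp only [ContinuousLinearEquiv.coe_coe, LinearEquiv.coe_toContinuousLinearEquiv_symm',
      LinearEquiv.symm_apply_apply]
    rw [h, ← div_eq_inv_mul, le_div_iff₀ hc]
    linarith

/-- In a space that does not contain the `ℓ∞^m` uniformly, the number of vectors of norm at least
`δ` in a weakly `1`-summable family is bounded. -/
theorem exists_card_le_of_weakly_summable {Y : Type*} [NormedAddCommGroup Y] [NormedSpace ℝ Y]
    (hY : ∀ C : ℝ, 1 ≤ C → ∃ m : ℕ,
      ¬∃ (Z : Subspace ℝ Y) (T : (Fin m → ℝ) ≃L[ℝ] Z),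
        ‖(T : (Fin m → ℝ) →L[ℝ] Z)‖ * ‖(T.symm : Z →L[ℝ] (Fin m → ℝ))‖ ≤ C)
    {L δ : ℝ} (hL : 0 ≤ L) (hδ : 0 < δ) :
    ∃ K : ℕ, ∀ {ι : Type} (Q : Finset ι) (v : ι → Y),
      (∀ φ : StrongDual ℝ Y, ‖φ‖ ≤ 1 → ∑ q ∈ Q, |φ (v q)| ≤ L) →
      (∀ q ∈ Q, δ ≤ ‖v q‖) → Q.card ≤ K := by
  classical
  obtain ⟨m, hm⟩ := hY (max 1 (L / (δ / 2))) (le_max_left _ _)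
  set η : ℝ := δ / (2 * (m + 1)) with hη
  have hη0 : 0 < η := by positivity
  have hmη : m * η ≤ δ / 2 := by
    rw [hη, mul_div_assoc', div_le_div_iff₀ (by positivity) (by positivity)]
    nlinarith
  refine ⟨(2 * ⌊L / η⌋₊ + 1) * m, fun {ι} Q v hsum hv => ?_⟩
  by_contra! hK
  choose φ hφ1 hφ using fun q => exists_dual_vector'' ℝ (v q)
  obtain ⟨s, hsQ, hsm, hind⟩ := exists_independent_of_outdegree_le
    (fun q r => η < |φ q (v r)|) ⌊L / η⌋₊ m Q (by
      intro q _ t ht hR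
      rw [Nat.le_floor_iff (by positivity), le_div_iff₀ hη0]
      calc (t.card : ℝ) * η = ∑ _r ∈ t, η := by simp
        _ ≤ ∑ r ∈ t, |φ q (v r)| := Finset.sum_le_sum fun r hr => (hR r hr).le
        _ ≤ ∑ r ∈ Q, |φ q (v r)| :=
          Finset.sum_le_sum_of_subset_of_nonneg ht fun _ _ _ => abs_nonneg _
        _ ≤ L := hsum _ (hφ1 q)) hK.le
  let e : Fin m ≃ s := (s.equivFinOfCardEq hsm).symm
  have hsum' : ∀ g : ι → ℝ, ∑ i, g (e i) = ∑ q ∈ s, g q := fun g => by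
    rw [← Finset.sum_coe_sort s g]
    exact Equiv.sum_comp e fun q : s => g q
  let S : (Fin m → ℝ) →ₗ[ℝ] Y := Fintype.linearCombination ℝ fun i => v (e i)
  have hS : ∀ a, S a = ∑ i, a i • v (e i) := fun a => rfl
  have hφS : ∀ (ψ : StrongDual ℝ Y) a, ψ (S a) = ∑ i, a i * ψ (v (e i)) := fun ψ a => by
    simp [hS]
  apply hm
  obtain ⟨Z, T, hT⟩ := exists_subspace_of_bounded_below S hL (half_pos hδ) (by
    intro a
    obtain ⟨ψ, hψ1, hψ⟩ := exists_dual_vector'' ℝ (S a)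
    calc ‖S a‖ = ∑ i, a i * ψ (v (e i)) := by rw [← hφS, hψ]; rfl
      _ ≤ ∑ i, ‖a‖ * |ψ (v (e i))| := Finset.sum_le_sum fun i _ => by
          refine (le_abs_self _).trans ?_
          rw [abs_mul]
          exact mul_le_mul_of_nonneg_right (norm_le_pi_norm a i) (abs_nonneg _)
      _ = ‖a‖ * ∑ q ∈ s, |ψ (v q)| := by
          rw [← Finset.mul_sum, hsum' fun q => |ψ (v q)|]
      _ ≤ ‖a‖ * L := mul_le_mul_of_nonneg_left
          ((Finset.sum_le_sum_of_subset_of_nonneg hsQ fun _ _ _ => abs_nonneg _).trans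
            (hsum ψ hψ1)) (norm_nonneg _)
      _ = L * ‖a‖ := mul_comm _ _) (by
    intro a
    have key : ∀ i, δ * |a i| ≤ ‖S a‖ + δ / 2 * ‖a‖ := by
      intro i
      have h1 : |φ (e i) (S a)| ≤ ‖S a‖ :=
        ((φ (e i)).le_opNorm _).trans (mul_le_of_le_one_left (norm_nonneg _) (hφ1 _))
      have h2 : φ (e i) (S a) = a i * ‖v (e i)‖ +
          ∑ j ∈ Finset.univ.erase i, a j * φ (e i) (v (e j)) := by
        rw [hφS, ← Finset.add_sum_erase _ _ (Finset.mem_univ i), hφ]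
        rfl
      have h3 : |∑ j ∈ Finset.univ.erase i, a j * φ (e i) (v (e j))| ≤ δ / 2 * ‖a‖ := by
        calc _ ≤ ∑ j ∈ Finset.univ.erase i, |a j * φ (e i) (v (e j))| :=
              Finset.abs_sum_le_sum_abs _ _
          _ ≤ ∑ j ∈ Finset.univ.erase i, ‖a‖ * η := Finset.sum_le_sum fun j hj => by
              rw [abs_mul]
              refine mul_le_mul (norm_le_pi_norm a j) (not_lt.1 ?_) (abs_nonneg _) (norm_nonneg _)
              refine hind _ (e i).2 _ (e j).2 fun h => ?_
              exact (Finset.mem_erase.1 hj).1 (e.injective (Subtype.ext h)).symm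
          _ ≤ ∑ _j : Fin m, ‖a‖ * η :=
              Finset.sum_le_sum_of_subset_of_nonneg (Finset.erase_subset _ _)
                fun _ _ _ => by positivity
          _ = ‖a‖ * (m * η) := by simp; ring
          _ ≤ δ / 2 * ‖a‖ := by nlinarith [norm_nonneg a]
      have h4 : δ * |a i| ≤ |a i * ‖v (e i)‖| := by
        rw [abs_mul, abs_norm, mul_comm]
        exact mul_le_mul_of_nonneg_left (hv _ (hsQ (e i).2)) (abs_nonneg _)
      have h5 : a i * ‖v (e i)‖ = φ (e i) (S a) -
          ∑ j ∈ Finset.univ.erase i, a j * φ (e i) (v (e j)) := by rw [h2]; ring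
      rw [h5] at h4
      linarith [abs_sub (φ (e i) (S a)) (∑ j ∈ Finset.univ.erase i, a j * φ (e i) (v (e j)))]
    have h : ‖a‖ ≤ (‖S a‖ + δ / 2 * ‖a‖) / δ := by
      refine (pi_norm_le_iff_of_nonneg (by positivity)).2 fun i => ?_
      rw [le_div_iff₀ hδ, mul_comm]
      exact key i
    rw [le_div_iff₀ hδ] at h
    linarith)
  exact ⟨Z, T, hT.trans (le_max_right _ _)⟩

/-- If `p * |B| ≤ |S|`, then permutations supported on `S` produce `p` disjoint copies of `B`. -/
theorem exists_perm_pairwise_disjoint_map {α : Type*} [DecidableEq α] {S B : Finset α}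
    {p : ℕ} (hBS : B ⊆ S) (h : p * B.card ≤ S.card) :
    ∃ τ : Fin p → Equiv.Perm α, (∀ q, ∀ a ∉ S, τ q a = a) ∧
      Pairwise fun q r => Disjoint (B.map (τ q).toEmbedding) (B.map (τ r).toEmbedding) := by
  classical
  obtain ⟨g⟩ : Nonempty (Fin p × B ↪ S) :=
    Function.Embedding.nonempty_of_card_le (by simpa using h)
  have hg : ∀ q : Fin p, Function.Injective fun b : {x : S // x.1 ∈ B} => g (q, ⟨b.1.1, b.2⟩) := by
    intro q a b hab
    have := g.injective hab
    simp only [Prod.mk.injEq, Subtype.mk.injEq, true_and] at this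
    exact Subtype.ext (Subtype.ext this)
  let e : ∀ q : Fin p, {x : S // x.1 ∈ B} ≃
      {x : S // x ∈ Set.range fun b : {x : S // x.1 ∈ B} => g (q, ⟨b.1.1, b.2⟩)} :=
    fun q => Equiv.ofInjective _ (hg q)
  have hτ : ∀ q, ∀ b (hb : b ∈ B),
      Equiv.Perm.ofSubtype (p := (· ∈ S)) (e q).extendSubtype b = g (q, ⟨b, hb⟩) := by
    intro q b hb
    rw [Equiv.Perm.ofSubtype_apply_of_mem _ (hBS hb),
      Equiv.extendSubtype_apply_of_mem (e q) ⟨b, hBS hb⟩ hb]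
    rfl
  refine ⟨fun q => Equiv.Perm.ofSubtype (p := (· ∈ S)) (e q).extendSubtype,
    fun q a ha => Equiv.Perm.ofSubtype_apply_of_not_mem _ ha, fun q r hqr => ?_⟩
  refine Finset.disjoint_left.2 fun x hx hx' => ?_
  obtain ⟨b, hb, rfl⟩ := Finset.mem_map.1 hx
  obtain ⟨b', hb', hbb⟩ := Finset.mem_map.1 hx'
  simp only [Equiv.coe_toEmbedding, hτ _ _ hb, hτ _ _ hb'] at hbb
  exact hqr (congrArg Prod.fst (g.injective (Subtype.ext hbb))).symm

/-- The characteristic vector of a finite set. -/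
def charVec {α : Type*} [DecidableEq α] (S : Finset α) : α → ℝ := fun x => if x ∈ S then 1 else 0

theorem charVec_map {α : Type*} [DecidableEq α] (S : Finset α) (σ : Equiv.Perm α) :
    charVec (S.map σ.toEmbedding) = charVec S ∘ σ.symm := by
  ext x
  simp [charVec, Finset.mem_map_equiv]

theorem norm_charVec_le {α : Type*} [Fintype α] [DecidableEq α] (S : Finset α) :
    ‖charVec S‖ ≤ 1 := by
  refine (pi_norm_le_iff_of_nonneg zero_le_one).2 fun x => ?_
  unfold charVec
  split_ifs <;> simp

theorem sum_abs_apply_charVec_le {α ι : Type*} [Fintype α] [DecidableEq α] [DecidableEq ι]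
    (ψ : StrongDual ℝ (α → ℝ)) {B : ι → Finset α}
    (hB : Pairwise fun q r => Disjoint (B q) (B r)) (Q : Finset ι) :
    ∑ q ∈ Q, |ψ (charVec (B q))| ≤ ‖ψ‖ := by
  have hsign : ∀ r : ℝ, ∃ c : ℝ, |c| ≤ 1 ∧ c * r = |r| := fun r => by
    rcases le_total 0 r with hr | hr
    · exact ⟨1, by simp, by rw [abs_of_nonneg hr, one_mul]⟩
    · exact ⟨-1, by simp, by rw [abs_of_nonpos hr]; ring⟩
  choose c hc hcm using hsign
  set a : α → ℝ := ∑ q ∈ Q, c (ψ (charVec (B q))) • charVec (B q) with ha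
  have ha1 : ‖a‖ ≤ 1 := by
    refine (pi_norm_le_iff_of_nonneg zero_le_one).2 fun x => ?_
    by_cases hx : ∃ q ∈ Q, x ∈ B q
    · obtain ⟨q, hq, hxq⟩ := hx
      rw [ha, Finset.sum_apply, Finset.sum_eq_single q]
      · simpa [charVec, hxq] using hc _
      · intro r _ hr
        simp [charVec, Finset.disjoint_left.1 (hB hr.symm) hxq]
      · exact fun h => absurd hq h
    · push Not at hx
      rw [ha, Finset.sum_apply, Finset.sum_eq_zero]
      · simp
      · intro q hq
        simp [charVec, hx q hq]
  calc ∑ q ∈ Q, |ψ (charVec (B q))| = ψ a := by simp [ha, hcm]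
    _ ≤ ‖ψ‖ * ‖a‖ := (le_abs_self _).trans (ψ.le_opNorm a)
    _ ≤ ‖ψ‖ := mul_le_of_le_one_right (norm_nonneg _) ha1

/-- Operators of norm at most `L` from `ℓ∞^n` into a space that does not contain the `ℓ∞^m`
uniformly are small on all but boundedly many members of a disjoint family of sets. -/
theorem exists_card_le_apply_charVec {Y : Type*} [NormedAddCommGroup Y] [NormedSpace ℝ Y]
    (hY : ∀ C : ℝ, 1 ≤ C → ∃ m : ℕ,
      ¬∃ (Z : Subspace ℝ Y) (T : (Fin m → ℝ) ≃L[ℝ] Z),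
        ‖(T : (Fin m → ℝ) →L[ℝ] Z)‖ * ‖(T.symm : Z →L[ℝ] (Fin m → ℝ))‖ ≤ C)
    {L δ : ℝ} (hL : 0 ≤ L) (hδ : 0 < δ) :
    ∃ K : ℕ, ∀ (n p : ℕ) (T : (Fin n → ℝ) →L[ℝ] Y) (B : Fin p → Finset (Fin n)), ‖T‖ ≤ L →
      (Pairwise fun q r => Disjoint (B q) (B r)) →
      ∀ Q : Finset (Fin p), (∀ q ∈ Q, δ ≤ ‖T (charVec (B q))‖) → Q.card ≤ K := by
  obtain ⟨K, hK⟩ := exists_card_le_of_weakly_summable hY hL hδ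
  refine ⟨K, fun n p T B hT hB Q hQ => hK Q (fun q => T (charVec (B q))) (fun φ hφ => ?_) hQ⟩
  refine (sum_abs_apply_charVec_le (φ.comp T) hB Q).trans ?_
  exact (φ.opNorm_comp_le T).trans ((mul_le_of_le_one_left (norm_nonneg _) hφ).trans hT)

/-- For a vector `x` constant on `S` and a much smaller `B ⊆ S`, the operator attached to a
rearrangement of `x` is small on the rearranged `B` for most rearrangements. -/
theorem mul_card_perm_le {Y : Type*} [NormedAddCommGroup Y] [NormedSpace ℝ Y] {L δ : ℝ} {K : ℕ}
    (hK : ∀ (n p : ℕ) (T : (Fin n → ℝ) →L[ℝ] Y) (B : Fin p → Finset (Fin n)), ‖T‖ ≤ L →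
      (Pairwise fun q r => Disjoint (B q) (B r)) →
      ∀ Q : Finset (Fin p), (∀ q ∈ Q, δ ≤ ‖T (charVec (B q))‖) → Q.card ≤ K)
    {n p : ℕ} (F : (Fin n → ℝ) → ((Fin n → ℝ) →L[ℝ] Y)) {x : Fin n → ℝ}
    (hF : ∀ σ : Equiv.Perm (Fin n), ‖F (x ∘ σ.symm)‖ ≤ L) {S B : Finset (Fin n)} (hBS : B ⊆ S)
    (hcard : p * B.card ≤ S.card) {c : ℝ} (hx : ∀ a ∈ S, x a = c)
    (P : Finset (Equiv.Perm (Fin n)))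
    (hP : ∀ σ ∈ P, δ ≤ ‖F (x ∘ σ.symm) (charVec (B.map σ.toEmbedding))‖) :
    p * P.card ≤ K * n.factorial := by
  classical
  obtain ⟨τ, hτS, hτB⟩ := exists_perm_pairwise_disjoint_map hBS hcard
  have hxτ : ∀ q, x ∘ (τ q).symm = x := by
    intro q
    ext a
    have hpre : x (τ q ((τ q).symm a)) = x ((τ q).symm a) := by
      by_cases h : (τ q).symm a ∈ S
      · by_cases h' : τ q ((τ q).symm a) ∈ S
        · rw [hx _ h, hx _ h']
        · have := hτS q _ h'
          rw [(τ q).injective this]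
      · rw [hτS q _ h]
    simpa using hpre.symm
  have hcount : ∀ q, (Finset.univ.filter fun σ => σ * τ q ∈ P).card = P.card := fun q => by
    refine Finset.card_bij (fun σ _ => σ * τ q) (by simp) (by simp) fun σ hσ => ?_
    exact ⟨σ * (τ q)⁻¹, by simpa using hσ, by simp⟩
  calc p * P.card = ∑ q : Fin p, (Finset.univ.filter fun σ => σ * τ q ∈ P).card := by
        simp [hcount]
    _ = ∑ σ : Equiv.Perm (Fin n), (Finset.univ.filter fun q => σ * τ q ∈ P).card :=
        (Finset.sum_card_bipartiteAbove_eq_sum_card_bipartiteBelow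
          fun (σ : Equiv.Perm (Fin n)) q => σ * τ q ∈ P).symm
    _ ≤ ∑ _σ : Equiv.Perm (Fin n), K := by
        refine Finset.sum_le_sum fun σ _ => ?_
        refine hK n p (F (x ∘ σ.symm))
          (fun q => (B.map (τ q).toEmbedding).map σ.toEmbedding) (hF σ) (fun q r hqr =>
            (Finset.disjoint_map _).2 (hτB hqr)) _ fun q hq => ?_
        have h := hP _ (Finset.mem_filter.1 hq).2
        have h1 : x ∘ (σ * τ q).symm = x ∘ σ.symm := by
          conv_rhs => rw [← hxτ q]
          rfl
        have h2 : B.map (σ * τ q).toEmbedding = (B.map (τ q).toEmbedding).map σ.toEmbedding := by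
          rw [Finset.map_map]
          rfl
        rwa [h1, h2] at h
    _ = K * n.factorial := by simp [Fintype.card_perm, mul_comm]

/-- First-order Taylor estimate for a map whose derivative has modulus of continuity `ω`. -/
theorem norm_sub_sub_le_of_modulus {E Y : Type*} [NormedAddCommGroup E] [NormedSpace ℝ E]
    [NormedAddCommGroup Y] [NormedSpace ℝ Y] {ω : ℝ → ℝ} (hω : MonotoneOn ω (Set.Ici 0))
    {f : E → Y} {f' : E → E →L[ℝ] Y} (hf : ∀ x ∈ ball (0 : E) 1, HasFDerivAt f (f' x) x)
    (hf' : ∀ x ∈ ball (0 : E) 1, ∀ y ∈ ball (0 : E) 1, ‖f' x - f' y‖ ≤ ω ‖x - y‖)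
    {x y : E} (hx : x ∈ ball (0 : E) 1) (hy : y ∈ ball (0 : E) 1) :
    ‖f y - f x - f' x (y - x)‖ ≤ ω ‖y - x‖ * ‖y - x‖ := by
  have hsub : segment ℝ x y ⊆ ball (0 : E) 1 := (convex_ball 0 1).segment_subset hx hy
  refine (convex_segment x y).norm_image_sub_le_of_norm_hasFDerivWithin_le' (f' := f')
    (fun z hz => (hf z (hsub hz)).hasFDerivWithinAt) (fun z hz => ?_)
    (left_mem_segment ℝ x y) (right_mem_segment ℝ x y)
  refine (hf' z (hsub hz) x hx).trans (hω (norm_nonneg _) (norm_nonneg _) ?_)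
  rw [← dist_eq_norm, ← dist_eq_norm, dist_comm z, dist_comm y]
  have := dist_add_dist_of_mem_segment hz
  linarith [dist_nonneg (x := z) (y := y)]

/-- Along a path in the ball with steps `h • charVec (E s)`, each nearly annihilated by the
derivative, the map changes little. -/
theorem norm_sub_le_of_path {Y : Type*} [NormedAddCommGroup Y] [NormedSpace ℝ Y] {ω : ℝ → ℝ}
    (hω : MonotoneOn ω (Set.Ici 0)) (hω0 : ∀ t, 0 ≤ t → 0 ≤ ω t) {n : ℕ} {f : (Fin n → ℝ) → Y}
    {f' : (Fin n → ℝ) → ((Fin n → ℝ) →L[ℝ] Y)}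
    (hf : ∀ x ∈ ball (0 : Fin n → ℝ) 1, HasFDerivAt f (f' x) x)
    (hf' : ∀ x ∈ ball (0 : Fin n → ℝ) 1, ∀ y ∈ ball (0 : Fin n → ℝ) 1,
      ‖f' x - f' y‖ ≤ ω ‖x - y‖)
    {h δ : ℝ} (hh : 0 ≤ h) {k : ℕ} {Z : ℕ → Fin n → ℝ} {E : ℕ → Finset (Fin n)}
    (hZ : ∀ s < k, Z (s + 1) = Z s + h • charVec (E s)) (hZ1 : ∀ s ≤ k, Z s ∈ ball 0 1)
    (hδ : ∀ s < k, ‖f' (Z s) (charVec (E s))‖ ≤ δ) :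
    ‖f (Z k) - f (Z 0)‖ ≤ k * (h * (δ + ω h)) := by
  have hstep : ∀ s < k, dist (f (Z s)) (f (Z (s + 1))) ≤ h * (δ + ω h) := by
    intro s hs
    have hT := norm_sub_sub_le_of_modulus hω hf hf' (hZ1 s hs.le) (hZ1 (s + 1) hs)
    have hsub : Z (s + 1) - Z s = h • charVec (E s) := by rw [hZ s hs]; abel
    have hn : ‖Z (s + 1) - Z s‖ ≤ h := by
      rw [hsub, norm_smul, Real.norm_of_nonneg hh]
      exact mul_le_of_le_one_right hh (norm_charVec_le _)
    have hωn : ω ‖Z (s + 1) - Z s‖ * ‖Z (s + 1) - Z s‖ ≤ ω h * h :=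
      mul_le_mul (hω (norm_nonneg _) hh hn) hn (norm_nonneg _) (hω0 h hh)
    have hd : ‖f' (Z s) (Z (s + 1) - Z s)‖ ≤ h * δ := by
      rw [hsub, map_smul, norm_smul, Real.norm_of_nonneg hh]
      exact mul_le_mul_of_nonneg_left (hδ s hs) hh
    rw [dist_comm, dist_eq_norm]
    calc ‖f (Z (s + 1)) - f (Z s)‖
        = ‖(f (Z (s + 1)) - f (Z s) - f' (Z s) (Z (s + 1) - Z s))
            + f' (Z s) (Z (s + 1) - Z s)‖ := by rw [sub_add_cancel]
      _ ≤ _ := norm_add_le _ _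
      _ ≤ h * (δ + ω h) := by linarith
  rw [← dist_eq_norm, dist_comm]
  refine (dist_le_range_sum_of_dist_le k fun {s} hs => hstep s hs).trans ?_
  simp

theorem comp_symm_mem_ball {α : Type*} [Fintype α] (σ : Equiv.Perm α) {x : α → ℝ}
    (hx : x ∈ ball (0 : α → ℝ) 1) : x ∘ σ.symm ∈ ball (0 : α → ℝ) 1 := by
  rw [mem_ball_zero_iff, pi_norm_lt_iff one_pos] at *
  exact fun i => hx _

/-- If every step of a path happens in a small part of a set on which the path is constant, then
`f` changes little along most rearrangements of the path. -/
theorem mul_card_perm_path_le {Y : Type*} [NormedAddCommGroup Y] [NormedSpace ℝ Y] {ω : ℝ → ℝ}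
    (hω : MonotoneOn ω (Set.Ici 0)) (hω0 : ∀ t, 0 ≤ t → 0 ≤ ω t) {L δ : ℝ} {K : ℕ}
    (hK : ∀ (n p : ℕ) (T : (Fin n → ℝ) →L[ℝ] Y) (B : Fin p → Finset (Fin n)), ‖T‖ ≤ L →
      (Pairwise fun q r => Disjoint (B q) (B r)) →
      ∀ Q : Finset (Fin p), (∀ q ∈ Q, δ ≤ ‖T (charVec (B q))‖) → Q.card ≤ K)
    {n p : ℕ} {f : (Fin n → ℝ) → Y} {f' : (Fin n → ℝ) → ((Fin n → ℝ) →L[ℝ] Y)}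
    (hf : ∀ x ∈ ball (0 : Fin n → ℝ) 1, HasFDerivAt f (f' x) x)
    (hf' : ∀ x ∈ ball (0 : Fin n → ℝ) 1, ∀ y ∈ ball (0 : Fin n → ℝ) 1,
      ‖f' x - f' y‖ ≤ ω ‖x - y‖)
    (hfL : ∀ x ∈ ball (0 : Fin n → ℝ) 1, ‖f' x‖ ≤ L)
    {h : ℝ} (hh : 0 ≤ h) {k : ℕ} {Z : ℕ → Fin n → ℝ} {E S : ℕ → Finset (Fin n)}
    (hZ : ∀ s < k, Z (s + 1) = Z s + h • charVec (E s)) (hZ1 : ∀ s ≤ k, Z s ∈ ball 0 1)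
    (hES : ∀ s < k, E s ⊆ S s) (hcard : ∀ s < k, p * (E s).card ≤ (S s).card)
    {c : ℕ → ℝ} (hc : ∀ s < k, ∀ a ∈ S s, Z s a = c s) (P : Finset (Equiv.Perm (Fin n)))
    (hP : ∀ σ ∈ P, k * (h * (δ + ω h)) < ‖f (Z k ∘ σ.symm) - f (Z 0 ∘ σ.symm)‖) :
    p * P.card ≤ k * (K * n.factorial) := by
  classical
  let bad : ℕ → Finset (Equiv.Perm (Fin n)) := fun s => Finset.univ.filter fun σ =>
    δ ≤ ‖f' (Z s ∘ σ.symm) (charVec ((E s).map σ.toEmbedding))‖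
  have hsub : P ⊆ (Finset.range k).biUnion bad := by
    intro σ hσ
    by_contra hnot
    simp only [bad, Finset.mem_biUnion, Finset.mem_range, Finset.mem_filter, Finset.mem_univ,
      true_and, not_exists, not_and, not_le] at hnot
    refine (hP σ hσ).not_ge ?_
    refine norm_sub_le_of_path hω hω0 hf hf' hh (Z := fun s => Z s ∘ σ.symm)
      (E := fun s => (E s).map σ.toEmbedding) (fun s hs => ?_)
      (fun s hs => comp_symm_mem_ball σ (hZ1 s hs)) fun s hs => (hnot s hs).le
    simp only [hZ s hs, charVec_map]
    rfl
  calc p * P.card ≤ p * ∑ s ∈ Finset.range k, (bad s).card :=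
        Nat.mul_le_mul_left _ ((Finset.card_le_card hsub).trans Finset.card_biUnion_le)
    _ = ∑ s ∈ Finset.range k, p * (bad s).card := Finset.mul_sum _ _ _
    _ ≤ ∑ _s ∈ Finset.range k, K * n.factorial := by
        refine Finset.sum_le_sum fun s hs => ?_
        have hs := Finset.mem_range.1 hs
        exact mul_card_perm_le hK f' (fun σ => hfL _ (comp_symm_mem_ball σ (hZ1 s hs.le)))
          (hES s hs) (hcard s hs) (hc s hs) _ fun σ hσ => (Finset.mem_filter.1 hσ).2
    _ = k * (K * n.factorial) := by simp

/-- The sizes of the sets in the chain used to reach a unit vector: each is more than `p` times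
the previous one. -/
def chainSize (p : ℕ) : ℕ → ℕ
  | 0 => 1
  | j + 1 => 1 + p * chainSize p j

theorem chainSize_pos (p j : ℕ) : 0 < chainSize p j := by
  cases j <;> simp [chainSize]

theorem chainSize_mono {p : ℕ} (hp : 1 ≤ p) : Monotone (chainSize p) :=
  monotone_nat_of_le_succ fun j => by
    rw [chainSize]
    nlinarith

/-- For most permutations `σ`, the values of `f` at `0` and at
the multiple `k * h` of the unit vector `e (σ 0)` are close. -/
theorem mul_card_perm_single_le {Y : Type*} [NormedAddCommGroup Y] [NormedSpace ℝ Y] {ω : ℝ → ℝ}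
    (hω : MonotoneOn ω (Set.Ici 0)) (hω0 : ∀ t, 0 ≤ t → 0 ≤ ω t) {L δ : ℝ} {K : ℕ}
    (hK : ∀ (n p : ℕ) (T : (Fin n → ℝ) →L[ℝ] Y) (B : Fin p → Finset (Fin n)), ‖T‖ ≤ L →
      (Pairwise fun q r => Disjoint (B q) (B r)) →
      ∀ Q : Finset (Fin p), (∀ q ∈ Q, δ ≤ ‖T (charVec (B q))‖) → Q.card ≤ K)
    {n p k : ℕ} (hp : 1 ≤ p) (hn : chainSize p k ≤ n + 1)
    {f : (Fin (n + 1) → ℝ) → Y} {f' : (Fin (n + 1) → ℝ) → ((Fin (n + 1) → ℝ) →L[ℝ] Y)}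
    (hf : ∀ x ∈ ball (0 : Fin (n + 1) → ℝ) 1, HasFDerivAt f (f' x) x)
    (hf' : ∀ x ∈ ball (0 : Fin (n + 1) → ℝ) 1, ∀ y ∈ ball (0 : Fin (n + 1) → ℝ) 1,
      ‖f' x - f' y‖ ≤ ω ‖x - y‖)
    (hfL : ∀ x ∈ ball (0 : Fin (n + 1) → ℝ) 1, ‖f' x‖ ≤ L)
    {h : ℝ} (hh : 0 ≤ h) (hkh : k * h < 1) (P : Finset (Equiv.Perm (Fin (n + 1))))
    (hP : ∀ σ ∈ P, 2 * (k * (h * (δ + ω h))) <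
      ‖f (Pi.single (σ 0) (k * h)) - f 0‖) :
    p * P.card ≤ 2 * (k * (K * (n + 1).factorial)) := by
  classical
  let A : ℕ → Finset (Fin (n + 1)) := fun s => Finset.univ.filter fun x => x.1 < chainSize p (k - s)
  have hmemA : ∀ s x, x ∈ A s ↔ x.1 < chainSize p (k - s) := by simp [A]
  have hA0 : ∀ s, 0 ∈ A s := fun s => (hmemA _ _).2 (chainSize_pos p _)
  have hAanti : ∀ r s, r ≤ s → A s ⊆ A r := fun r s hrs x hx =>
    (hmemA _ _).2 (((hmemA _ _).1 hx).trans_le (chainSize_mono hp (Nat.sub_le_sub_left hrs k)))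
  have hAcard : ∀ s, (A s).card = chainSize p (k - s) := fun s => by
    have : chainSize p (k - s) ≤ n + 1 := (chainSize_mono hp (Nat.sub_le k s)).trans hn
    simp only [A, Fin.card_filter_val_lt]
    omega
  have hAstep : ∀ s < k, (A s).card = 1 + p * (A (s + 1)).card := fun s hs => by
    rw [hAcard, hAcard, show k - s = (k - (s + 1)) + 1 by omega, chainSize]
  have hDcard : ∀ s, ((A s).erase 0).card = (A s).card - 1 := fun s =>
    Finset.card_erase_of_mem (hA0 s)
  let X : ℕ → Fin (n + 1) → ℝ := fun s => ∑ r ∈ Finset.range s, h • charVec (A (r + 1))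
  let W : ℕ → Fin (n + 1) → ℝ := fun s => X s + Pi.single 0 (k * h - s * h)
  have hXapp : ∀ s x, X s x = ∑ r ∈ Finset.range s, h * charVec (A (r + 1)) x := by simp [X]
  have hXA : ∀ s, ∀ a ∈ A s, X s a = s * h := by
    intro s a ha
    rw [hXapp, Finset.sum_congr rfl (g := fun _ => h)]
    · simp
    · intro r hr
      have : a ∈ A (r + 1) := hAanti _ _ (Finset.mem_range.1 hr) ha
      simp [charVec, this]
  have hcv : ∀ (S : Finset (Fin (n + 1))) x, 0 ≤ charVec S x ∧ charVec S x ≤ 1 := by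
    intro S x
    unfold charVec
    split_ifs <;> norm_num
  have hX0 : ∀ s x, 0 ≤ X s x := fun s x => by
    rw [hXapp]
    exact Finset.sum_nonneg fun r _ => mul_nonneg hh (hcv _ _).1
  have hXle : ∀ s x, X s x ≤ s * h := fun s x => by
    rw [hXapp]
    refine (Finset.sum_le_sum fun r _ => mul_le_of_le_one_right hh (hcv _ _).2).trans ?_
    simp
  have hsk : ∀ s ≤ k, (s : ℝ) * h ≤ k * h := fun s hs =>
    mul_le_mul_of_nonneg_right (by exact_mod_cast hs) hh
  have hXball : ∀ s ≤ k, X s ∈ ball 0 1 := fun s hs => by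
    rw [mem_ball_zero_iff, pi_norm_lt_iff one_pos]
    intro x
    rw [Real.norm_of_nonneg (hX0 s x)]
    exact ((hXle s x).trans (hsk s hs)).trans_lt hkh
  have hWne : ∀ s x, x ≠ 0 → W s x = X s x := fun s x hx => by simp [W, hx]
  have hWball : ∀ s ≤ k, W s ∈ ball 0 1 := fun s hs => by
    rw [mem_ball_zero_iff, pi_norm_lt_iff one_pos]
    intro x
    by_cases hx : x = 0
    · have : W s x = k * h := by simp [W, hx, hXA s 0 (hA0 s)]
      rw [this, Real.norm_of_nonneg (by positivity)]
      exact hkh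
    · rw [hWne s x hx, Real.norm_of_nonneg (hX0 s x)]
      exact ((hXle s x).trans (hsk s hs)).trans_lt hkh
  have hXstep : ∀ s, X (s + 1) = X s + h • charVec (A (s + 1)) := fun s =>
    Finset.sum_range_succ _ s
  have hWstep : ∀ s, W (s + 1) = W s + h • charVec ((A (s + 1)).erase 0) := fun s => by
    ext x
    by_cases hx : x = 0
    · subst hx
      simp [W, hXstep, charVec, hA0]
      ring
    · simp [W, hXstep, charVec, hx]
  let P₁ := P.filter fun σ => k * (h * (δ + ω h)) < ‖f (X k ∘ σ.symm) - f (X 0 ∘ σ.symm)‖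
  let P₂ := P.filter fun σ => k * (h * (δ + ω h)) < ‖f (W k ∘ σ.symm) - f (W 0 ∘ σ.symm)‖
  have hP₁ : p * P₁.card ≤ k * (K * (n + 1).factorial) :=
    mul_card_perm_path_le hω hω0 hK hf hf' hfL hh (S := A) (fun s _ => hXstep s) hXball
      (fun s _ => hAanti _ _ s.le_succ) (fun s hs => by rw [hAstep s hs]; omega)
      (fun s _ => hXA s) P₁ fun σ hσ => (Finset.mem_filter.1 hσ).2
  have hP₂ : p * P₂.card ≤ k * (K * (n + 1).factorial) :=
    mul_card_perm_path_le hω hω0 hK hf hf' hfL hh (S := fun s => (A s).erase 0)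
      (c := fun s => s * h) (fun s _ => hWstep s) hWball
      (fun s _ => Finset.erase_subset_erase _ (hAanti _ _ s.le_succ))
      (fun s hs => by
        rw [hDcard, hDcard, hAstep s hs, Nat.add_sub_cancel_left]
        exact Nat.mul_le_mul_left _ (Nat.sub_le _ _))
      (fun s _ a ha => by
        rw [hWne s a (Finset.mem_erase.1 ha).1, hXA s a (Finset.mem_erase.1 ha).2]) P₂
      fun σ hσ => (Finset.mem_filter.1 hσ).2
  have hcover : P ⊆ P₁ ∪ P₂ := by
    intro σ hσ
    by_contra hnot
    simp only [P₁, P₂, Finset.mem_union, Finset.mem_filter, hσ, true_and, not_or, not_lt] at hnot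
    have hWk : W k = X k := by simp [W]
    have hX0' : X 0 ∘ σ.symm = 0 := by
      ext x
      simp [X]
    have hW0 : W 0 ∘ σ.symm = Pi.single (σ 0) (k * h) := by
      ext x
      simp [W, X, Pi.single_apply, Equiv.symm_apply_eq]
    rw [hX0', hWk, hW0] at hnot
    have htri := norm_sub_le_norm_sub_add_norm_sub (f (Pi.single (σ 0) (k * h)))
      (f (X k ∘ σ.symm)) (f 0)
    rw [norm_sub_rev (f (Pi.single (σ 0) _)) (f (X k ∘ σ.symm))] at htri
    linarith [hP σ hσ]
  calc p * P.card ≤ p * (P₁.card + P₂.card) :=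
        Nat.mul_le_mul_left _ ((Finset.card_le_card hcover).trans (Finset.card_union_le _ _))
    _ ≤ _ := by rw [mul_add]; omega

/-- If the Banach space `Y` does not contain the spaces `ℓ∞^m` uniformly (equivalently,
by Maurey–Pisier, `Y` has non-trivial cotype), then for each modulus `ω`, `L > 0` and
`ε > 0` there is `N` such that every `L`-Lipschitz `f ∈ C^{1,+}(B_{ℓ∞ⁿ}; Y)`, `n ≥ N`,
with derivative of modulus `ω` sends two distinct unit vectors `ε`-close together. -/
theorem exists_close_unit_vectors_of_no_uniform_ell_infty
    (ω : ℝ → ℝ) (hω : IsModulus ω) (L ε : ℝ) (hL : 0 < L) (hε : 0 < ε)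
    (Y : Type u) [NormedAddCommGroup Y] [NormedSpace ℝ Y] [CompleteSpace Y]
    (hY : ∀ C : ℝ, 1 ≤ C → ∃ m : ℕ,
      ¬∃ (Z : Subspace ℝ Y) (T : (Fin m → ℝ) ≃L[ℝ] Z),
        ‖(T : (Fin m → ℝ) →L[ℝ] Z)‖ * ‖(T.symm : Z →L[ℝ] (Fin m → ℝ))‖ ≤ C) :
    ∃ N : ℕ, ∀ n : ℕ, N ≤ n →
      ∀ (f : (Fin n → ℝ) → Y) (f' : (Fin n → ℝ) → ((Fin n → ℝ) →L[ℝ] Y)),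
        ContinuousOn f (closedBall 0 1) →
        (∀ x ∈ closedBall (0 : Fin n → ℝ) 1, ∀ y ∈ closedBall (0 : Fin n → ℝ) 1,
          ‖f x - f y‖ ≤ L * ‖x - y‖) →
        (∀ x ∈ ball (0 : Fin n → ℝ) 1, HasFDerivAt f (f' x) x) →
        (∀ x ∈ ball (0 : Fin n → ℝ) 1, ∀ y ∈ ball (0 : Fin n → ℝ) 1,
          ‖f' x - f' y‖ ≤ ω ‖x - y‖) →
        ∃ i j : Fin n, i ≠ j ∧
          ‖f (Pi.single i 1 : Fin n → ℝ) - f (Pi.single j 1 : Fin n → ℝ)‖ < ε := by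
  classical
  obtain ⟨hω0, hωm, hω00, hωc⟩ := hω
  obtain ⟨K, hK⟩ := exists_card_le_apply_charVec hY hL.le (show 0 < ε / 16 by positivity)
  obtain ⟨γ, hγ0, hγ1, hγL⟩ : ∃ γ : ℝ, 0 < γ ∧ γ < 1 ∧ L * γ ≤ ε / 8 := by
    refine ⟨min (1 / 2) (ε / 8 / L), by positivity, by
      exact (min_le_left _ _).trans_lt (by norm_num), ?_⟩
    calc L * min (1 / 2) (ε / 8 / L) ≤ L * (ε / 8 / L) :=
          mul_le_mul_of_nonneg_left (min_le_right _ _) hL.le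
      _ = ε / 8 := by field_simp
  obtain ⟨η, hη0, hη⟩ : ∃ η > 0, ∀ t, 0 ≤ t → t < η → ω t < ε / 16 := by
    obtain ⟨η, hη0, hη⟩ := Metric.continuousWithinAt_iff.1 hωc (ε / 16) (by positivity)
    refine ⟨η, hη0, fun t ht htη => ?_⟩
    have := hη (x := t) ht (by rwa [Real.dist_eq, sub_zero, abs_of_nonneg ht])
    rw [hω00, Real.dist_eq, sub_zero] at this
    exact (le_abs_self _).trans_lt this
  obtain ⟨k, hk⟩ := exists_nat_gt (1 / η)
  have hk0 : (0 : ℝ) < k := (by positivity : 0 < 1 / η).trans hk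
  set h : ℝ := (1 - γ) / k with hh
  have hh0 : 0 ≤ h := div_nonneg (by linarith) hk0.le
  have hkh : k * h = 1 - γ := by rw [hh]; field_simp
  have hhη : h < η := by
    rw [div_lt_iff₀ hη0] at hk
    rw [hh, div_lt_iff₀ hk0]
    linarith
  set p : ℕ := 4 * (k * K) + 1 with hp
  refine ⟨chainSize p k + 2, fun n hn f f' _ hLip hdf hmod => ?_⟩
  obtain ⟨n, rfl⟩ : ∃ m, n = m + 1 + 1 := ⟨n - 2, by omega⟩
  have hfL : ∀ x ∈ ball (0 : Fin (n + 1 + 1) → ℝ) 1, ‖f' x‖ ≤ L := fun x hx => by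
    refine (hdf x hx).le_of_lip' hL.le ?_
    filter_upwards [isOpen_ball.mem_nhds hx] with y hy
    exact hLip y (ball_subset_closedBall hy) x (ball_subset_closedBall hx)
  have hη2 : 2 * (k * (h * (ε / 16 + ω h))) ≤ ε / 4 := by
    have h1 : k * (h * (ε / 16 + ω h)) ≤ 1 * (ε / 16 + ω h) := by
      rw [← mul_assoc]
      exact mul_le_mul_of_nonneg_right (by linarith) (by linarith [hω0 h hh0])
    linarith [hη h hh0 hhη]
  set P : Finset (Equiv.Perm (Fin (n + 1 + 1))) := Finset.univ.filter fun σ =>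
    2 * (k * (h * (ε / 16 + ω h))) < ‖f (Pi.single (σ 0) (k * h)) - f 0‖ with hP
  have hPc := mul_card_perm_single_le hωm hω0 hK (by omega : 1 ≤ p)
    (by omega : chainSize p k ≤ n + 1 + 1) hdf hmod hfL hh0 (by linarith) P
    fun σ hσ => (Finset.mem_filter.1 hσ).2
  obtain ⟨σ, hσ, hσ'⟩ : ∃ σ, σ ∉ P ∧ σ * Equiv.swap 0 1 ∉ P := by
    by_contra! hcon
    let P' := Finset.univ.filter fun σ => σ * Equiv.swap 0 1 ∈ P
    have hP' : P'.card ≤ P.card :=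
      Finset.card_le_card_of_injOn (· * Equiv.swap 0 1) (fun σ hσ => (Finset.mem_filter.1 hσ).2)
        (mul_left_injective _).injOn
    have huniv : (Finset.univ : Finset (Equiv.Perm (Fin (n + 1 + 1)))) ⊆ P ∪ P' := fun σ _ => by
      by_cases hσ : σ ∈ P
      · exact Finset.mem_union_left _ hσ
      · exact Finset.mem_union_right _ (Finset.mem_filter.2 ⟨Finset.mem_univ _, hcon σ hσ⟩)
    have hc := (Finset.card_le_card huniv).trans (Finset.card_union_le _ _)
    rw [Finset.card_univ, Fintype.card_perm, Fintype.card_fin] at hc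
    have hfac := Nat.factorial_pos (n + 1 + 1)
    generalize (n + 1 + 1).factorial = N at *
    have h1 : p * N ≤ p * (2 * P.card) := Nat.mul_le_mul_left _ (by omega)
    rw [hp] at h1 hPc
    nlinarith
  have hclose : ∀ σ ∉ P, ‖f (Pi.single (σ 0) 1) - f 0‖ ≤ 3 * ε / 8 := by
    intro σ hσ
    have h1 : ‖f (Pi.single (σ 0) (k * h)) - f 0‖ ≤ ε / 4 := by
      simp only [hP, Finset.mem_filter, Finset.mem_univ, true_and, not_lt] at hσ
      exact hσ.trans hη2
    have h2 := hLip (Pi.single (σ 0) 1) (by simp [Pi.norm_single])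
      (Pi.single (σ 0) (k * h)) (by
        rw [mem_closedBall_zero_iff, Pi.norm_single, hkh, Real.norm_of_nonneg (by linarith)]
        linarith)
    rw [← Pi.single_sub, Pi.norm_single, hkh, Real.norm_of_nonneg (by linarith)] at h2
    rw [hkh] at h1
    have h3 := norm_sub_le_norm_sub_add_norm_sub (f (Pi.single (σ 0) 1))
      (f (Pi.single (σ 0) (1 - γ))) (f 0)
    rw [sub_sub_cancel] at h2
    linarith
  refine ⟨σ 0, σ 1, by simp, ?_⟩
  have h1 := hclose σ hσ
  have h2 := hclose _ hσ'
  rw [Equiv.Perm.mul_apply, Equiv.swap_apply_left, norm_sub_rev] at h2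
  have h3 := norm_sub_le_norm_sub_add_norm_sub (f (Pi.single (σ 0) 1)) (f 0) (f (Pi.single (σ 1) 1))
  linarith
end

section
/- Let φ : ℝ → ℝ be continuously differentiable with φ(0) = 0 and φ'(0) = 0. Then the mapping Φ : c₀ → c₀ defined coordinatewise by Φ((x_k)_{k=1}^∞) = (φ(x_k))_{k=1}^∞ is Fréchet differentiable at every x = (x_k) ∈ c₀, its derivative is the diagonal operator dΦ(x)[h] = (φ'(x_k) h_k)_{k=1}^∞, and dΦ(x) is a compact linear operator from c₀ into c₀ for every x ∈ c₀. -/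
open ZeroAtInfty

namespace ZeroAtInftyContinuousMap

open Filter Topology

lemma norm_le_of_forall {α : Type*} [TopologicalSpace α] (f : C₀(α, ℝ)) {C : ℝ} (hC : 0 ≤ C)
    (h : ∀ k, ‖f k‖ ≤ C) : ‖f‖ ≤ C := by
  rw [← norm_toBCF_eq_norm]
  exact (BoundedContinuousFunction.norm_le hC).2 h

lemma norm_apply_le {α : Type*} [TopologicalSpace α] (f : C₀(α, ℝ)) (k : α) : ‖f k‖ ≤ ‖f‖ := by
  rw [← norm_toBCF_eq_norm]
  exact f.toBCF.norm_coe_le_norm k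

/-- Postcomposition with a continuous function vanishing at `0`. -/
def postcomp {α : Type*} [TopologicalSpace α] (g : ℝ → ℝ) (hg : Continuous g) (hg0 : g 0 = 0)
    (x : C₀(α, ℝ)) : C₀(α, ℝ) where
  toFun k := g (x k)
  continuous_toFun := hg.comp x.continuous
  zero_at_infty' := by
    have := (hg.tendsto 0).comp x.zero_at_infty'
    rwa [hg0] at this

/-- Evaluation at a point, as a continuous linear functional. -/
noncomputable def evalCLM {α : Type*} [TopologicalSpace α] (k : α) : C₀(α, ℝ) →L[ℝ] ℝ :=
  LinearMap.mkContinuous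
    { toFun := fun f => f k
      map_add' := fun _ _ => rfl
      map_smul' := fun _ _ => rfl } 1 fun f => by simpa using norm_apply_le f k

/-- The function on `ℕ` taking the value `c` at `k` and `0` elsewhere. -/
noncomputable def single (k : ℕ) (c : ℝ) : C₀(ℕ, ℝ) where
  toFun := Pi.single k c
  continuous_toFun := continuous_of_discreteTopology
  zero_at_infty' := by
    rw [cocompact_eq_cofinite, Nat.cofinite_eq_atTop]
    refine tendsto_const_nhds.congr' ?_
    filter_upwards [eventually_gt_atTop k] with n hn
    simp [hn.ne']

lemma single_apply (k : ℕ) (c : ℝ) (n : ℕ) : single k c n = if n = k then c else 0 :=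
  Pi.single_apply k c n

lemma isCompactOperator_mul_single (k : ℕ) (c : ℝ) :
    IsCompactOperator (ContinuousLinearMap.mul ℝ C₀(ℕ, ℝ) (single k c)) := by
  have h : ContinuousLinearMap.mul ℝ C₀(ℕ, ℝ) (single k c) =
      (ContinuousLinearMap.toSpanSingleton ℝ (single k c)).comp (evalCLM k) := by
    ext f n
    change single k c n * f n = f k * single k c n
    rw [single_apply]
    split_ifs with hn
    · rw [hn, mul_comm]
    · simp
  rw [h]
  exact (isCompactOperator_of_locallyCompactSpace_rng
    (ContinuousLinearMap.toSpanSingleton ℝ (single k c))).comp_clm (evalCLM k)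

lemma sum_single_apply (a : C₀(ℕ, ℝ)) (N n : ℕ) :
    (∑ k ∈ Finset.range N, single k (a k)) n = if n < N then a n else 0 := by
  change evalCLM n _ = _
  rw [map_sum]
  change ∑ k ∈ Finset.range N, single k (a k) n = _
  simp [single_apply]

lemma tendsto_sum_single (a : C₀(ℕ, ℝ)) :
    Tendsto (fun N => ∑ k ∈ Finset.range N, single k (a k)) atTop (𝓝 a) := by
  rw [Metric.tendsto_atTop]
  intro ε hε
  have ha := a.zero_at_infty'
  rw [cocompact_eq_cofinite, Nat.cofinite_eq_atTop, Metric.tendsto_atTop] at ha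
  obtain ⟨N₀, hN₀⟩ := ha (ε / 2) (half_pos hε)
  refine ⟨N₀, fun N hN => lt_of_le_of_lt ?_ (half_lt_self hε)⟩
  rw [dist_eq_norm]
  refine norm_le_of_forall _ (half_pos hε).le fun n => ?_
  rw [sub_apply, sum_single_apply]
  split_ifs with hn
  · simpa using (half_pos hε).le
  · simpa using (hN₀ n (hN.trans (not_lt.1 hn))).le

/-- Diagonal operators on `c₀` with symbol in `c₀` are compact. -/
lemma isCompactOperator_mul (a : C₀(ℕ, ℝ)) :
    IsCompactOperator (ContinuousLinearMap.mul ℝ C₀(ℕ, ℝ) a) := by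
  refine isCompactOperator_of_tendsto (l := atTop)
    (((ContinuousLinearMap.mul ℝ C₀(ℕ, ℝ)).continuous.tendsto a).comp (tendsto_sum_single a))
    (Eventually.of_forall fun N => ?_)
  simp only [Function.comp_apply, map_sum]
  induction N with
  | zero => simpa using isCompactOperator_zero
  | succ N ih =>
    rw [Finset.sum_range_succ]
    exact ih.add (isCompactOperator_mul_single N (a N))

end ZeroAtInftyContinuousMap

/-- First order Taylor estimate for a `C¹` function, uniform on bounded sets. -/
lemma exists_forall_norm_sub_sub_mul_le {φ φ' : ℝ → ℝ} (hderiv : ∀ t, HasDerivAt φ (φ' t) t)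
    (hcont : Continuous φ') (R : ℝ) {ε : ℝ} (hε : 0 < ε) :
    ∃ δ > 0, ∀ s t : ℝ, ‖s‖ ≤ R → ‖t - s‖ < δ → ‖φ t - φ s - φ' s * (t - s)‖ ≤ ε * ‖t - s‖ := by
  obtain ⟨δ, hδ, H⟩ := Metric.uniformContinuousOn_iff.1
    ((isCompact_closedBall (0 : ℝ) (R + 1)).uniformContinuousOn_of_continuous hcont.continuousOn)
    ε hε
  refine ⟨min δ 1, lt_min hδ one_pos, fun s t hs hst => ?_⟩
  have hr : 0 < min δ 1 := lt_min hδ one_pos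
  have key := (convex_ball s (min δ 1)).norm_image_sub_le_of_norm_hasDerivWithin_le
    (f := fun u => φ u - φ' s * u) (f' := fun u => φ' u - φ' s) (C := ε) (x := s) (y := t)
    (fun u _ => by
      simpa using ((hderiv u).fun_sub ((hasDerivAt_id' u).const_mul (φ' s))).hasDerivWithinAt)
    (fun u hu => by
      have hu' : dist u s < min δ 1 := hu
      have hus : ‖u‖ ≤ R + 1 := by
        have h1 := norm_add_le s (u - s)
        rw [add_sub_cancel, ← dist_eq_norm] at h1
        linarith [min_le_right δ 1]
      have := H u (by simpa using hus) s (by simpa using hs.trans (by linarith))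
        (hu'.trans_le (min_le_left _ _))
      rw [dist_eq_norm] at this
      exact this.le)
    (Metric.mem_ball_self hr) (by rwa [Metric.mem_ball, dist_eq_norm])
  calc ‖φ t - φ s - φ' s * (t - s)‖ = ‖φ t - φ' s * t - (φ s - φ' s * s)‖ := by congr 1; ring
    _ ≤ ε * ‖t - s‖ := key

open ZeroAtInftyContinuousMap in
/-- A coordinatewise map on `C₀(α, ℝ)` induced by a `C¹` function is Fréchet differentiable, with
derivative a multiplication operator. -/
lemma ZeroAtInftyContinuousMap.hasFDerivAt_of_apply_eq {α : Type*} [TopologicalSpace α]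
    {φ φ' : ℝ → ℝ} (hderiv : ∀ t, HasDerivAt φ (φ' t) t) (hcont : Continuous φ')
    {Φ : C₀(α, ℝ) → C₀(α, ℝ)} (hΦ : ∀ x k, Φ x k = φ (x k)) (x : C₀(α, ℝ))
    {D : C₀(α, ℝ) →L[ℝ] C₀(α, ℝ)} (hD : ∀ h k, D h k = φ' (x k) * h k) :
    HasFDerivAt Φ D x := by
  rw [hasFDerivAt_iff_isLittleO, Asymptotics.isLittleO_iff]
  intro ε hε
  obtain ⟨δ, hδ, H⟩ := exists_forall_norm_sub_sub_mul_le hderiv hcont ‖x‖ hε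
  filter_upwards [Metric.ball_mem_nhds x hδ] with y hy
  rw [Metric.mem_ball, dist_eq_norm] at hy
  refine norm_le_of_forall _ (by positivity) fun k => ?_
  have hk : ‖y k - x k‖ ≤ ‖y - x‖ := norm_apply_le (y - x) k
  rw [sub_apply, sub_apply, hΦ, hΦ, hD, sub_apply]
  exact (H _ _ (norm_apply_le x k) (hk.trans_lt hy)).trans (by gcongr)

/-- Let `φ : ℝ → ℝ` be `C¹` with `φ(0) = 0` and `φ'(0) = 0`. Then the coordinatewise
mapping `Φ((x_k)) = (φ(x_k))` is a well-defined map of `c₀ = C₀(ℕ, ℝ)` into itself,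
it is Fréchet differentiable at every `x ∈ c₀` with derivative the diagonal operator
`h ↦ (φ'(x_k) h_k)`, and this derivative is a compact operator on `c₀`. -/
theorem coordinatewise_map_c0_differentiable_compact_derivative
    (φ φ' : ℝ → ℝ) (hderiv : ∀ t, HasDerivAt φ (φ' t) t) (hcont : Continuous φ')
    (h0 : φ 0 = 0) (h0' : φ' 0 = 0) :
    (∃ Φ : C₀(ℕ, ℝ) → C₀(ℕ, ℝ), ∀ (x : C₀(ℕ, ℝ)) (k : ℕ), Φ x k = φ (x k)) ∧
    ∀ Φ : C₀(ℕ, ℝ) → C₀(ℕ, ℝ), (∀ (x : C₀(ℕ, ℝ)) (k : ℕ), Φ x k = φ (x k)) →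
      ∀ x : C₀(ℕ, ℝ), ∃ D : C₀(ℕ, ℝ) →L[ℝ] C₀(ℕ, ℝ),
        (∀ (h : C₀(ℕ, ℝ)) (k : ℕ), D h k = φ' (x k) * h k) ∧
        HasFDerivAt Φ D x ∧ IsCompactOperator D := by
  have hφ : Continuous φ := continuous_iff_continuousAt.2 fun t => (hderiv t).continuousAt
  refine ⟨⟨ZeroAtInftyContinuousMap.postcomp φ hφ h0, fun _ _ => rfl⟩, fun Φ hΦ x => ?_⟩
  have hD (h : C₀(ℕ, ℝ)) (k : ℕ) : ContinuousLinearMap.mul ℝ C₀(ℕ, ℝ)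
      (ZeroAtInftyContinuousMap.postcomp φ' hcont h0' x) h k = φ' (x k) * h k := rfl
  exact ⟨_, hD, ZeroAtInftyContinuousMap.hasFDerivAt_of_apply_eq hderiv hcont hΦ x hD,
    ZeroAtInftyContinuousMap.isCompactOperator_mul _⟩
end

section
/- Let Γ be an infinite set, X a Banach space, and F ∈ C^{1,+}(B_{ℓ∞(Γ)}; X). Then the family (F(e_γ) − F(0))_{γ∈Γ} is weakly null in the strong sense that for every φ ∈ X* and every ε > 0 the set {γ ∈ Γ : |φ(F(e_γ) − F(0))| > ε} is finite. -/
open Metric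

/-- The indicator function of a set, as an element of `ℓ∞(Γ)`. -/
noncomputable def lpIndicator {Γ : Type*} (A : Set Γ) : lp (fun _ : Γ => ℝ) ⊤ :=
  ⟨A.indicator 1, memℓp_infty ⟨1, by
    rintro _ ⟨γ, rfl⟩
    by_cases h : γ ∈ A <;> simp [h]⟩⟩

lemma lpIndicator_apply {Γ : Type*} (A : Set Γ) (γ : Γ) :
    lpIndicator A γ = A.indicator (1 : Γ → ℝ) γ := rfl

lemma norm_lpIndicator_le {Γ : Type*} (A : Set Γ) : ‖lpIndicator A‖ ≤ 1 := by
  refine lp.norm_le_of_forall_le zero_le_one fun γ => ?_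
  by_cases h : γ ∈ A <;> simp [lpIndicator_apply, h]

lemma lpIndicator_apply_of_notMem {Γ : Type*} {A : Set Γ} {γ : Γ} (h : γ ∉ A) :
    lpIndicator A γ = 0 := by
  simp [lpIndicator_apply, h]

lemma lpIndicator_eq_single_add {Γ : Type*} [DecidableEq Γ] {A : Set Γ} {i : Γ} (hi : i ∈ A) :
    lpIndicator A = lp.single ⊤ i 1 + lpIndicator (A \ {i}) := by
  ext γ
  rw [lp.coeFn_add, Pi.add_apply, lpIndicator_apply, lpIndicator_apply]
  rcases eq_or_ne γ i with rfl | h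
  · simp [hi]
  · rw [lp.single_apply_ne _ _ _ h]
    by_cases hA : γ ∈ A <;> simp [hA, h]

lemma norm_single_one_le {Γ : Type*} [DecidableEq Γ] (i : Γ) :
    ‖(lp.single ⊤ i 1 : lp (fun _ : Γ => ℝ) ⊤)‖ ≤ 1 := by
  refine lp.norm_le_of_forall_le zero_le_one fun γ => ?_
  rcases eq_or_ne γ i with rfl | h
  · simp
  · rw [lp.single_apply_ne _ _ _ h]; simp

lemma norm_add_le_one_of_disjoint_support {Γ : Type*} {v w : lp (fun _ : Γ => ℝ) ⊤}
    (hv : ‖v‖ ≤ 1) (hw : ‖w‖ ≤ 1) (h : ∀ γ, v γ = 0 ∨ w γ = 0) : ‖v + w‖ ≤ 1 := by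
  refine lp.norm_le_of_forall_le zero_le_one fun γ => ?_
  rw [lp.coeFn_add, Pi.add_apply]
  rcases h γ with h | h
  · rw [h, zero_add]
    exact (lp.norm_apply_le_norm ENNReal.top_ne_zero w γ).trans hw
  · rw [h, add_zero]
    exact (lp.norm_apply_le_norm ENNReal.top_ne_zero v γ).trans hv

/-- A version of Rosenthal's lemma for functionals on `ℓ∞(Γ)` whose norms on the vectors supported
in `S` are at most `m * η`. -/
lemma exists_infinite_subset_abs_le_of_le_mul {Γ : Type*}
    (L : Γ → lp (fun _ : Γ => ℝ) ⊤ →L[ℝ] ℝ) {η : ℝ} (hη : 0 ≤ η) (m : ℕ) :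
    ∀ S : Set Γ, S.Infinite →
      (∀ n ∈ S, ∀ v, (∀ γ ∉ S, v γ = 0) → ‖v‖ ≤ 1 → |L n v| ≤ m * η) →
      ∃ A ⊆ S, A.Infinite ∧
        ∀ n ∈ A, ∀ v, (∀ γ ∉ A \ {n}, v γ = 0) → ‖v‖ ≤ 1 → |L n v| ≤ η := by
  induction m with
  | zero =>
    intro S hS h
    refine ⟨S, subset_rfl, hS, fun n hn v hv hv1 => ?_⟩
    have h0 := h n hn v (fun γ hγ => hv γ fun h' => hγ h'.1) hv1
    rw [Nat.cast_zero, zero_mul] at h0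
    exact h0.trans hη
  | succ m ih =>
    intro S hS h
    by_contra hcon
    push Not at hcon
    have := hS.to_subtype
    let g : ℕ × ℕ → Γ := fun x => Infinite.natEmbedding S (Nat.pairEquiv x)
    have hg : Function.Injective g := Subtype.val_injective.comp
      ((Infinite.natEmbedding S).injective.comp Nat.pairEquiv.injective)
    have hgS : ∀ x, g x ∈ S := fun x => Subtype.prop _
    let N : ℕ → Set Γ := fun p => Set.range fun q => g (p, q)
    have hNS : ∀ p, N p ⊆ S := by
      rintro p _ ⟨q, rfl⟩
      exact hgS _
    have hNinf : ∀ p, (N p).Infinite := fun p =>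
      Set.infinite_range_of_injective fun a b hab => (Prod.mk.inj (hg hab)).2
    have hNdisj : ∀ p q γ, γ ∈ N p → γ ∈ N q → p = q := by
      rintro p q _ ⟨a, rfl⟩ ⟨b, hb⟩
      exact (Prod.mk.inj (hg hb)).1.symm
    choose n hn v hv hv1 hvL using fun p => hcon (N p) (hNS p) (hNinf p)
    have hninj : Function.Injective n := fun p q hpq =>
      hNdisj p q (n p) (hn p) (hpq ▸ hn q)
    have hsub : Set.range n ⊆ S := by
      rintro _ ⟨p, rfl⟩
      exact hNS p (hn p)
    obtain ⟨A, hA, hAinf, hAL⟩ := ih (Set.range n) (Set.infinite_range_of_injective hninj) <| by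
      rintro _ ⟨p, rfl⟩ w hw hw1
      have hdisj : ∀ γ, v p γ = 0 ∨ w γ = 0 := by
        intro γ
        by_contra! hne
        obtain ⟨q, rfl⟩ : γ ∈ Set.range n := by
          by_contra h'
          exact hne.2 (hw γ h')
        have hmem : n q ∈ N p \ {n p} := by
          by_contra h'
          exact hne.1 (hv p _ h')
        exact hmem.2 (by rw [hNdisj p q (n q) hmem.1 (hn q)]; rfl)
      have hsupp : ∀ γ ∉ S, v p γ = 0 ∧ w γ = 0 := fun γ hγ =>
        ⟨hv p γ fun h' => hγ (hNS p h'.1), hw γ fun h' => hγ (hsub h')⟩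
      have h1 := h (n p) (hsub ⟨p, rfl⟩) (v p + w)
        (fun γ hγ => by simp [hsupp γ hγ])
        (norm_add_le_one_of_disjoint_support (hv1 p) hw1 hdisj)
      have h2 := h (n p) (hsub ⟨p, rfl⟩) (v p + -w)
        (fun γ hγ => by simp [hsupp γ hγ])
        (norm_add_le_one_of_disjoint_support (hv1 p) (by rwa [norm_neg])
          fun γ => (hdisj γ).imp_right fun h' => by simp [h'])
      have h3 := hvL p
      rw [map_add] at h1 h2
      rw [map_neg] at h2
      push_cast at h1 h2
      rw [abs_le] at h1 h2 ⊢
      rcases lt_abs.1 h3 with h3 | h3 <;> constructor <;> linarith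
    obtain ⟨k, hk, w, hw, hw1, hwL⟩ := hcon A (hA.trans hsub) hAinf
    exact absurd (hAL k hk w hw hw1) (not_le.2 hwL)

/-- **Rosenthal's lemma** for bounded families of functionals on `ℓ∞(Γ)`. -/
lemma exists_infinite_subset_abs_le {Γ : Type*}
    (L : Γ → lp (fun _ : Γ => ℝ) ⊤ →L[ℝ] ℝ) {η C : ℝ} (hη : 0 < η) {S : Set Γ}
    (hS : S.Infinite) (hC : ∀ n ∈ S, ‖L n‖ ≤ C) :
    ∃ A ⊆ S, A.Infinite ∧
      ∀ n ∈ A, ∀ v, (∀ γ ∉ A \ {n}, v γ = 0) → ‖v‖ ≤ 1 → |L n v| ≤ η := by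
  obtain ⟨m, hm⟩ := exists_nat_ge (C / η)
  refine exists_infinite_subset_abs_le_of_le_mul L hη.le m S hS fun n hn v _ hv => ?_
  calc |L n v| ≤ ‖L n‖ := (L n).unit_le_opNorm v hv
    _ ≤ C := hC n hn
    _ ≤ m * η := (div_le_iff₀ hη).1 hm

/-- For an infinite bounded family of functionals together with one further functional, there is an
infinite set of indices on which all of them are small off the diagonal. -/
lemma exists_infinite_subset_abs_le_and {Γ : Type*}
    (L : Γ → lp (fun _ : Γ => ℝ) ⊤ →L[ℝ] ℝ) (L₀ : lp (fun _ : Γ => ℝ) ⊤ →L[ℝ] ℝ) {η C : ℝ}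
    (hη : 0 < η) {S : Set Γ} (hS : S.Infinite) (hC : ∀ n ∈ S, ‖L n‖ ≤ C) :
    ∃ A ⊆ S, A.Infinite ∧ |L₀ (lpIndicator A)| ≤ η ∧
      ∀ n ∈ A, |L n (lpIndicator (A \ {n}))| ≤ η := by
  obtain ⟨A, hAS, hA, hAL⟩ := exists_infinite_subset_abs_le L hη hS hC
  obtain ⟨B, hBA, hB, hBL⟩ :=
    exists_infinite_subset_abs_le (fun _ => L₀) hη hA fun _ _ => le_refl ‖L₀‖
  obtain ⟨b, hb⟩ := hB.nonempty
  refine ⟨B \ {b}, Set.sdiff_subset.trans (hBA.trans hAS), hB.sdiff (Set.finite_singleton b),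
    hBL b hb _ (fun γ hγ => lpIndicator_apply_of_notMem hγ) (norm_lpIndicator_le _),
    fun n hn => hAL n (hBA hn.1) _ (fun γ hγ => lpIndicator_apply_of_notMem fun h => hγ ?_)
      (norm_lpIndicator_le _)⟩
  exact ⟨hBA h.1.1, h.2⟩

lemma UniformContinuousOn.exists_norm_le_of_ball {E G : Type*} [NormedAddCommGroup E]
    [NormedSpace ℝ E] [SeminormedAddCommGroup G] {g : E → G}
    (hg : UniformContinuousOn g (ball 0 1)) : ∃ C, ∀ x ∈ ball (0 : E) 1, ‖g x‖ ≤ C := by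
  obtain ⟨δ, hδ, h⟩ := Metric.uniformContinuousOn_iff.1 hg 1 one_pos
  obtain ⟨N, hN⟩ := exists_nat_one_div_lt hδ
  refine ⟨‖g 0‖ + (N + 1), fun x hx => ?_⟩
  have hN0 : (0 : ℝ) < N + 1 := by positivity
  rw [mem_ball_zero_iff] at hx
  have hmem : ∀ j : ℕ, j ≤ N + 1 → ((j : ℝ) / (N + 1)) • x ∈ ball (0 : E) 1 := by
    intro j hj
    rw [mem_ball_zero_iff, norm_smul, Real.norm_of_nonneg (by positivity)]
    have : (j : ℝ) / (N + 1) ≤ 1 := by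
      rw [div_le_one hN0]
      exact_mod_cast hj
    nlinarith [norm_nonneg x]
  have key : ∀ j : ℕ, j ≤ N + 1 → ‖g (((j : ℝ) / (N + 1)) • x)‖ ≤ ‖g 0‖ + j := by
    intro j
    induction j with
    | zero => simp
    | succ j ih =>
      intro hj
      have hd := h _ (hmem (j + 1) hj) _ (hmem j (by omega)) <| by
        rw [dist_eq_norm, ← sub_smul, norm_smul, ← sub_div, Nat.cast_succ, add_sub_cancel_left,
          Real.norm_of_nonneg (by positivity)]
        have : 0 < 1 / ((N : ℝ) + 1) := by positivity
        nlinarith [norm_nonneg x]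
      rw [dist_eq_norm] at hd
      have := norm_le_norm_add_norm_sub' (g (((j + 1 : ℕ) / ((N : ℝ) + 1)) • x))
        (g (((j : ℝ) / (N + 1)) • x))
      have := ih (by omega)
      push_cast at *
      linarith
  have := key (N + 1) le_rfl
  push_cast at this
  rwa [div_self hN0.ne', one_smul] at this

section

variable {Γ : Type*} {f : lp (fun _ : Γ => ℝ) ⊤ → ℝ}
  {f' : lp (fun _ : Γ => ℝ) ⊤ → (lp (fun _ : Γ => ℝ) ⊤ →L[ℝ] ℝ)} {δ η : ℝ}

lemma abs_sub_le_of_abs_fderiv_le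
    (hf : ∀ x ∈ ball (0 : lp (fun _ : Γ => ℝ) ⊤) 1, HasFDerivAt f (f' x) x) (hδ : 0 ≤ δ)
    (hf' : ∀ x ∈ ball (0 : lp (fun _ : Γ => ℝ) ⊤) 1, ∀ y ∈ ball (0 : lp (fun _ : Γ => ℝ) ⊤) 1,
      dist x y ≤ δ → ‖f' x - f' y‖ ≤ η)
    {x v : lp (fun _ : Γ => ℝ) ⊤} (hx : x ∈ ball (0 : lp (fun _ : Γ => ℝ) ⊤) 1)
    (hxv : x + δ • v ∈ ball (0 : lp (fun _ : Γ => ℝ) ⊤) 1) (hv : ‖v‖ ≤ 1)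
    (hL : |f' x v| ≤ η) : |f (x + δ • v) - f x| ≤ 2 * (δ * η) := by
  have hη : 0 ≤ η := (abs_nonneg _).trans hL
  have hnorm : ‖δ • v‖ ≤ δ := by
    rw [norm_smul, Real.norm_of_nonneg hδ]
    exact mul_le_of_le_one_right hδ hv
  have hseg : segment ℝ x (x + δ • v) ⊆ ball 0 1 := (convex_ball 0 1).segment_subset hx hxv
  have h := (convex_segment x (x + δ • v)).norm_image_sub_le_of_norm_hasFDerivWithin_le'
    (f := f) (f' := f') (φ := f' x) (C := η)
    (fun y hy => (hf y (hseg hy)).hasFDerivWithinAt)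
    (fun y hy => hf' y (hseg hy) x hx ?_) (left_mem_segment ℝ _ _) (right_mem_segment ℝ _ _)
  · rw [add_sub_cancel_left, map_smul, smul_eq_mul, Real.norm_eq_abs] at h
    have h1 : η * ‖δ • v‖ ≤ δ * η := by nlinarith
    have h2 : |δ * f' x v| ≤ δ * η := by
      rw [abs_mul, abs_of_nonneg hδ]
      exact mul_le_mul_of_nonneg_left hL hδ
    rw [abs_le] at *
    constructor <;> linarith
  · obtain ⟨t, ht, rfl⟩ := (segment_eq_image' ℝ x (x + δ • v)) ▸ hy
    rw [dist_eq_norm, add_sub_cancel_left, add_sub_cancel_left, norm_smul,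
      Real.norm_of_nonneg ht.1]
    exact (mul_le_of_le_one_left (norm_nonneg _) ht.2).trans hnorm

lemma exists_abs_apply_single_sub_le [DecidableEq Γ]
    (hf : ∀ x ∈ ball (0 : lp (fun _ : Γ => ℝ) ⊤) 1, HasFDerivAt f (f' x) x) (hδ : 0 ≤ δ)
    (hη : 0 < η)
    (hf' : ∀ x ∈ ball (0 : lp (fun _ : Γ => ℝ) ⊤) 1, ∀ y ∈ ball (0 : lp (fun _ : Γ => ℝ) ⊤) 1,
      dist x y ≤ δ → ‖f' x - f' y‖ ≤ η)
    {C : ℝ} (hC : ∀ x ∈ ball (0 : lp (fun _ : Γ => ℝ) ⊤) 1, ‖f' x‖ ≤ C) (k : ℕ) :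
    ∀ (S : Set Γ) (p : lp (fun _ : Γ => ℝ) ⊤), S.Infinite → ‖p‖ + k * δ < 1 →
      ∃ i ∈ S, |f (p + (k * δ) • lp.single ⊤ i 1) - f p| ≤ k * (4 * (δ * η)) := by
  induction k with
  | zero =>
    intro S p hS _
    obtain ⟨i, hi⟩ := hS.nonempty
    exact ⟨i, hi, by simp⟩
  | succ k ih =>
    intro S p hS hp
    push_cast at hp ⊢
    have hkδ : 0 ≤ k * δ := by positivity
    have hsmul : ∀ {c : ℝ} {u : lp (fun _ : Γ => ℝ) ⊤}, 0 ≤ c → ‖u‖ ≤ 1 → ‖c • u‖ ≤ c := by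
      intro c u hc hu
      rw [norm_smul, Real.norm_of_nonneg hc]
      exact mul_le_of_le_one_right hc hu
    have hmem : ∀ i, p + ((k + 1) * δ) • lp.single ⊤ i 1 ∈
        ball (0 : lp (fun _ : Γ => ℝ) ⊤) 1 := fun i => by
      rw [mem_ball_zero_iff]
      have h1 := hsmul (c := (k + 1) * δ) (by positivity) (norm_single_one_le i)
      linarith [norm_add_le p (((k + 1) * δ) • lp.single ⊤ i 1)]
    obtain ⟨A, hAS, hA, hA0, hAL⟩ := exists_infinite_subset_abs_le_and
      (fun i => f' (p + ((k + 1) * δ) • lp.single ⊤ i 1)) (f' p) hη hS fun i _ => hC _ (hmem i)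
    have hpA : ‖p + δ • lpIndicator A‖ ≤ ‖p‖ + δ :=
      (norm_add_le _ _).trans (by gcongr; exact hsmul hδ (norm_lpIndicator_le A))
    obtain ⟨i, hiA, hi⟩ := ih A (p + δ • lpIndicator A) hA (by linarith)
    refine ⟨i, hAS hiA, ?_⟩
    have heq : p + δ • lpIndicator A + (k * δ) • lp.single ⊤ i 1 =
        p + ((k + 1) * δ) • lp.single ⊤ i 1 + δ • lpIndicator (A \ {i}) := by
      rw [lpIndicator_eq_single_add hiA]
      module
    have hmem' : p + δ • lpIndicator A + (k * δ) • lp.single ⊤ i 1 ∈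
        ball (0 : lp (fun _ : Γ => ℝ) ⊤) 1 := by
      rw [mem_ball_zero_iff]
      have h1 := hsmul hkδ (norm_single_one_le i)
      linarith [norm_add_le (p + δ • lpIndicator A) ((k * δ) • lp.single ⊤ i 1)]
    rw [heq] at hi hmem'
    have h1 := abs_sub_le_of_abs_fderiv_le hf hδ hf' (hmem i) hmem' (norm_lpIndicator_le _)
      (hAL i hiA)
    have h2 := abs_sub_le_of_abs_fderiv_le hf hδ hf' (x := p) (v := lpIndicator A)
      (by rw [mem_ball_zero_iff]; linarith) (by rw [mem_ball_zero_iff]; linarith)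
      (norm_lpIndicator_le _) hA0
    rw [abs_le] at *
    constructor <;> linarith

end

/-- For any infinite set `Γ` and `F ∈ C^{1,+}(B_{ℓ∞(Γ)}; X)`, the family
`(F(e_γ) - F(0))_γ` is weakly null in the strong sense: for every `φ ∈ X*` and `ε > 0`,
the set `{γ : |φ(F(e_γ) - F(0))| > ε}` is finite. -/
theorem weakly_null_image_of_unit_vectors
    {Γ : Type*} [Infinite Γ] [DecidableEq Γ]
    {X : Type*} [NormedAddCommGroup X] [NormedSpace ℝ X] [CompleteSpace X]
    (F : lp (fun _ : Γ => ℝ) ⊤ → X)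
    (F' : lp (fun _ : Γ => ℝ) ⊤ → (lp (fun _ : Γ => ℝ) ⊤ →L[ℝ] X))
    (hFcont : ContinuousOn F (closedBall 0 1))
    (hFderiv : ∀ x ∈ ball (0 : lp (fun _ : Γ => ℝ) ⊤) 1, HasFDerivAt F (F' x) x)
    (hF'unif : UniformContinuousOn F' (ball 0 1)) :
    ∀ (φ : X →L[ℝ] ℝ) (ε : ℝ), 0 < ε →
      {γ : Γ | ε < |φ (F (lp.single ⊤ γ 1) - F 0)|}.Finite := by
  intro φ ε hε
  by_contra hinf
  have hf : ∀ x ∈ ball (0 : lp (fun _ : Γ => ℝ) ⊤) 1,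
      HasFDerivAt (fun x => φ (F x)) (φ.comp (F' x)) x :=
    fun x hx => φ.hasFDerivAt.comp x (hFderiv x hx)
  have hcont : ContinuousOn (fun x => φ (F x)) (closedBall 0 1) :=
    φ.continuous.comp_continuousOn hFcont
  have hunif : UniformContinuousOn (fun x => φ.comp (F' x)) (ball 0 1) :=
    (ContinuousLinearMap.compL ℝ (lp (fun _ : Γ => ℝ) ⊤) X ℝ φ).uniformContinuous
      |>.comp_uniformContinuousOn hF'unif
  obtain ⟨C, hC⟩ := hunif.exists_norm_le_of_ball
  have hC0 : 0 ≤ C := (norm_nonneg _).trans (hC 0 (mem_ball_self one_pos))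
  have hlip : LipschitzOnWith C.toNNReal (fun x => φ (F x)) (closedBall 0 1) := by
    rw [← closure_ball _ one_ne_zero] at hcont ⊢
    refine LipschitzOnWith.closure hcont <|
      (convex_ball 0 1).lipschitzOnWith_of_nnnorm_hasFDerivWithin_le
        (fun x hx => (hf x hx).hasFDerivWithinAt) fun x hx => ?_
    rw [← NNReal.coe_le_coe, coe_nnnorm, Real.coe_toNNReal C hC0]
    exact hC x hx
  obtain ⟨δ₀, hδ₀, hd⟩ := Metric.uniformContinuousOn_iff.1 hunif (ε / 8) (by positivity)
  obtain ⟨k, hk⟩ := exists_nat_one_div_lt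
    (lt_min hδ₀ (by positivity : 0 < ε / (2 * (C + 1))))
  set δ : ℝ := 1 / ((k : ℝ) + 1) with hδ
  have hδpos : 0 < δ := by positivity
  have hkδ : k * δ = 1 - δ := by rw [hδ]; field_simp; ring
  obtain ⟨i, hi, hle⟩ := exists_abs_apply_single_sub_le hf hδpos.le
    (by positivity : 0 < ε / 8) (fun x hx y hy hxy => by
      rw [← dist_eq_norm]
      exact (hd x hx y hy (hxy.trans_lt (hk.trans_le (min_le_left _ _)))).le) hC k _ 0 hinf
    (by rw [norm_zero, hkδ]; linarith)
  have hnorm := norm_single_one_le i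
  have hmul : ‖(k * δ) • (lp.single ⊤ i 1 : lp (fun _ : Γ => ℝ) ⊤)‖ ≤ 1 := by
    rw [norm_smul, Real.norm_of_nonneg (by positivity)]
    nlinarith [norm_nonneg (lp.single ⊤ i 1 : lp (fun _ : Γ => ℝ) ⊤)]
  have hend := hlip.dist_le_mul (lp.single ⊤ i 1) (mem_closedBall_zero_iff.2 hnorm)
    ((k * δ) • lp.single ⊤ i 1) (mem_closedBall_zero_iff.2 hmul)
  have hdist : dist (lp.single ⊤ i 1 : lp (fun _ : Γ => ℝ) ⊤) ((k * δ) • lp.single ⊤ i 1) ≤ δ := by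
    have : (lp.single ⊤ i 1 : lp (fun _ : Γ => ℝ) ⊤) - (k * δ) • lp.single ⊤ i 1 =
        δ • lp.single ⊤ i 1 := by
      rw [hkδ]
      module
    rw [dist_eq_norm, this, norm_smul, Real.norm_of_nonneg hδpos.le]
    exact mul_le_of_le_one_right hδpos.le hnorm
  rw [Real.coe_toNNReal C hC0, Real.dist_eq] at hend
  have hCδ : C * δ ≤ ε / 2 := by
    have h1 := (lt_div_iff₀ (by positivity)).1 (hk.trans_le (min_le_right _ _))
    nlinarith
  have hend' := hend.trans ((mul_le_mul_of_nonneg_left hdist hC0).trans hCδ)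
  rw [zero_add] at hle
  have hle' : k * (4 * (δ * (ε / 8))) ≤ ε / 2 := by
    have : k * (4 * (δ * (ε / 8))) = (k * δ) * (ε / 2) := by ring
    rw [this, hkδ]
    nlinarith
  have hle'' := hle.trans hle'
  rw [Set.mem_ofPred_eq, map_sub] at hi
  have htri := abs_sub_le (φ (F (lp.single ⊤ i 1))) (φ (F ((k * δ) • lp.single ⊤ i 1))) (φ (F 0))
  linarith
end
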